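/- Let c(n) denote the total number of diagonal-lattice walks of length n that start at (0,0) and are confined to the three-quadrant cone C (with arbitrary endpoint). Then c(n) is asymptotically equivalent, as n → ∞, to (2^3 · √3 / (3^2 · Γ(2/3))) · 4^n / n^{1/3}, where Γ is the Gamma function. -/

import Mathlib

/-- Square-lattice steps. -/
def squareSteps : Set (ℤ × ℤ) := {(1,0), (-1,0), (0,1), (0,-1)}

/-- Diagonal-lattice steps. -/
def diagSteps : Set (ℤ × ℤ) := {(1,1), (1,-1), (-1,1), (-1,-1)}

/-- The three-quadrant cone `C = {(i,j) : i ≥ 0 or j ≥ 0}`. -/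
def coneC : Set (ℤ × ℤ) := {p | 0 ≤ p.1 ∨ 0 ≤ p.2}

/-- The quadrant `Q = {(i,j) : i ≥ 0 and j ≥ 0}`. -/
def quadQ : Set (ℤ × ℤ) := {p | 0 ≤ p.1 ∧ 0 ≤ p.2}

/-- Number of walks of length `n` with steps in `steps`, from `a` to `b`,
confined to `region`. -/
noncomputable def walkCount (steps region : Set (ℤ × ℤ)) (a b : ℤ × ℤ) (n : ℕ) : ℕ :=
  Nat.card {w : Fin (n+1) → ℤ × ℤ //
    w 0 = a ∧ w (Fin.last n) = b ∧
    (∀ k : Fin n, w k.succ - w k.castSucc ∈ steps) ∧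
    (∀ k, w k ∈ region)}

/-- Number of walks of length `n` with steps in `steps`, starting at `a`,
confined to `region` (arbitrary endpoint). -/
noncomputable def walkCountAll (steps region : Set (ℤ × ℤ)) (a : ℤ × ℤ) (n : ℕ) : ℕ :=
  Nat.card {w : Fin (n+1) → ℤ × ℤ //
    w 0 = a ∧
    (∀ k : Fin n, w k.succ - w k.castSucc ∈ steps) ∧
    (∀ k, w k ∈ region)}

namespace ThreeQuadrant

open Set Filter Topology Metric

section Green

variable {α 𝕜 : Type*} [RCLike 𝕜]

/-- The weighted adjacency operator of the directed graph with neighbour lists `N`. -/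
def walkOp {R : Type*} [CommSemiring R] (N : α → List α) (t : R) : (α → R) →ₗ[R] (α → R) where
  toFun φ x := t * ((N x).map φ).sum
  map_add' φ ψ := by
    funext x
    simp only [Pi.add_apply]
    rw [← mul_add, ← List.sum_map_add]
    rfl
  map_smul' c φ := by
    funext x
    simp only [Pi.smul_apply, smul_eq_mul, RingHom.id_apply]
    have : ((N x).map (c • φ)).sum = c * ((N x).map φ).sum := List.sum_map_mul_left _ _ _
    rw [this]
    ring

lemma walkOp_apply {R : Type*} [CommSemiring R] (N : α → List α) (t : R) (φ : α → R) (x : α) :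
    walkOp N t φ x = t * ((N x).map φ).sum := rfl

lemma walkOp_pow_succ {R : Type*} [CommSemiring R] (N : α → List α) (t : R) (φ : α → R) (n : ℕ) :
    (walkOp N t ^ (n + 1)) φ = walkOp N t ((walkOp N t ^ n) φ) := by
  rw [pow_succ']; rfl

lemma walkOp_pow_succ_right {R : Type*} [CommSemiring R] (N : α → List α) (t : R) (φ : α → R)
    (n : ℕ) : (walkOp N t ^ (n + 1)) φ = (walkOp N t ^ n) (walkOp N t φ) := by
  rw [pow_succ]; rfl

lemma norm_list_sum_map_le (l : List α) (φ : α → 𝕜) (χ : α → ℝ) (h : ∀ x, ‖φ x‖ ≤ χ x) :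
    ‖(l.map φ).sum‖ ≤ (l.map χ).sum := by
  induction l with
  | nil => simp
  | cons a l ih =>
    simp only [List.map_cons, List.sum_cons]
    exact (norm_add_le _ _).trans (add_le_add (h a) ih)

lemma norm_walkOp_pow_le {N : α → List α} {t : ℝ} (ht : 0 ≤ t) {φ : α → 𝕜} {χ : α → ℝ}
    (h : ∀ x, ‖φ x‖ ≤ χ x) (n : ℕ) (x : α) :
    ‖(walkOp N (t : 𝕜) ^ n) φ x‖ ≤ (walkOp N t ^ n) χ x := by
  induction n generalizing x with
  | zero => simpa using h x
  | succ n ih =>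
    rw [walkOp_pow_succ, walkOp_pow_succ, walkOp_apply, walkOp_apply, norm_mul,
      RCLike.norm_ofReal, abs_of_nonneg ht]
    exact mul_le_mul_of_nonneg_left (norm_list_sum_map_le _ _ _ ih) ht

lemma walkOp_pow_const_le {N : α → List α} (hN : ∀ x, (N x).length ≤ 4) {s M : ℝ} (hs : 0 ≤ s)
    (hM : 0 ≤ M) (n : ℕ) (x : α) : (walkOp N (s / 4) ^ n) (fun _ => M) x ≤ s ^ n * M := by
  induction n generalizing x with
  | zero => simp
  | succ n ih =>
    rw [walkOp_pow_succ, walkOp_apply]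
    have h1 : ((N x).map ((walkOp N (s / 4) ^ n) (fun _ => M))).sum ≤ 4 * (s ^ n * M) := by
      have h2 : ((N x).map ((walkOp N (s / 4) ^ n) (fun _ => M))).sum
          ≤ ((N x).map (fun _ => s ^ n * M)).sum := List.sum_le_sum fun i _ => ih i
      have h3 : ((N x).length : ℝ) ≤ 4 := by exact_mod_cast hN x
      have h4 : 0 ≤ s ^ n * M := by positivity
      simp only [List.map_const', List.sum_replicate, nsmul_eq_mul] at h2
      nlinarith
    calc s / 4 * _ ≤ s / 4 * (4 * (s ^ n * M)) := mul_le_mul_of_nonneg_left h1 (by positivity)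
      _ = s ^ (n + 1) * M := by ring

lemma norm_walkOp_pow_le_geometric {N : α → List α} (hN : ∀ x, (N x).length ≤ 4) {s M : ℝ}
    (hs : 0 ≤ s) (hM : 0 ≤ M) {φ : α → 𝕜} (h : ∀ x, ‖φ x‖ ≤ M) (n : ℕ) (x : α) :
    ‖(walkOp N ((s / 4 : ℝ) : 𝕜) ^ n) φ x‖ ≤ s ^ n * M :=
  (norm_walkOp_pow_le (by positivity) h n x).trans (walkOp_pow_const_le hN hs hM n x)

/-- The Green operator `∑ (s/4)ⁿ Aⁿ` of the directed graph with neighbour lists `N`. -/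
noncomputable def green (N : α → List α) (s : ℝ) (φ : α → 𝕜) (x : α) : 𝕜 :=
  ∑' n, (walkOp N ((s / 4 : ℝ) : 𝕜) ^ n) φ x

variable {N : α → List α} {s : ℝ}

lemma summable_green (hN : ∀ x, (N x).length ≤ 4) (hs : 0 ≤ s) (hs1 : s < 1) {M : ℝ}
    {φ : α → 𝕜} (h : ∀ x, ‖φ x‖ ≤ M) (x : α) :
    Summable fun n => (walkOp N ((s / 4 : ℝ) : 𝕜) ^ n) φ x := by
  have hM : 0 ≤ M := (norm_nonneg _).trans (h x)
  exact Summable.of_norm_bounded ((summable_geometric_of_lt_one hs hs1).mul_right M)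
    fun n => norm_walkOp_pow_le_geometric hN hs hM h n x

lemma green_add (hN : ∀ x, (N x).length ≤ 4) (hs : 0 ≤ s) (hs1 : s < 1) {M M' : ℝ}
    {φ ψ : α → 𝕜} (h : ∀ x, ‖φ x‖ ≤ M) (h' : ∀ x, ‖ψ x‖ ≤ M') (x : α) :
    green N s (φ + ψ) x = green N s φ x + green N s ψ x := by
  unfold green
  rw [← (summable_green hN hs hs1 h x).tsum_add (summable_green hN hs hs1 h' x)]
  simp

lemma green_smul (c : 𝕜) (φ : α → 𝕜) (x : α) :
    green N s (c • φ) x = c * green N s φ x := by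
  unfold green
  rw [← tsum_mul_left]
  simp

lemma green_sub_walkOp (hN : ∀ x, (N x).length ≤ 4) (hs : 0 ≤ s) (hs1 : s < 1) {M : ℝ}
    {φ : α → 𝕜} (h : ∀ x, ‖φ x‖ ≤ M) (x : α) :
    green N s (φ - walkOp N ((s / 4 : ℝ) : 𝕜) φ) x = φ x := by
  have hS := summable_green hN hs hs1 h x
  unfold green
  have h1 : ∀ n, (walkOp N ((s / 4 : ℝ) : 𝕜) ^ n) (φ - walkOp N ((s / 4 : ℝ) : 𝕜) φ) x
      = (walkOp N ((s / 4 : ℝ) : 𝕜) ^ n) φ x - (walkOp N ((s / 4 : ℝ) : 𝕜) ^ (n + 1)) φ x := by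
    intro n
    rw [walkOp_pow_succ_right, map_sub]; rfl
  simp_rw [h1]
  rw [hS.tsum_sub ((summable_nat_add_iff 1).2 hS), hS.tsum_eq_zero_add]
  simp

lemma walkOp_pow_ofReal (φ : α → ℝ) (n : ℕ) (x : α) (t : ℝ) :
    (walkOp N (t : 𝕜) ^ n) (fun y => (φ y : 𝕜)) x = ((walkOp N t ^ n) φ x : 𝕜) := by
  induction n generalizing x with
  | zero => simp
  | succ n ih =>
    rw [walkOp_pow_succ, walkOp_pow_succ, walkOp_apply, walkOp_apply]
    have : ∀ l : List α, (l.map ((walkOp N (t : 𝕜) ^ n) (fun y => (φ y : 𝕜)))).sum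
        = ((l.map ((walkOp N t ^ n) φ)).sum : 𝕜) := by
      intro l
      induction l with
      | nil => simp
      | cons a l ihl => simp [ih, ihl]
    rw [this]
    push_cast
    rfl

lemma green_ofReal (φ : α → ℝ) (x : α) :
    green N s (fun y => (φ y : ℂ)) x = ((green N s φ x : ℝ) : ℂ) := by
  unfold green
  rw [Complex.ofReal_tsum]
  exact tsum_congr fun n => walkOp_pow_ofReal (𝕜 := ℂ) φ n x (s / 4)

lemma walkOp_pow_diffContOnCl {φ : ℂ → α → ℂ} {U : Set ℂ}
    (h : ∀ y, DiffContOnCl ℂ (fun z => φ z y) U) (t : ℂ) (n : ℕ) (x : α) :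
    DiffContOnCl ℂ (fun z => (walkOp N t ^ n) (φ z) x) U := by
  induction n generalizing x with
  | zero => simpa using h x
  | succ n ih =>
    simp only [walkOp_pow_succ, walkOp_apply]
    have : ∀ l : List α, DiffContOnCl ℂ (fun z => (l.map ((walkOp N t ^ n) (φ z))).sum) U := by
      intro l
      induction l with
      | nil => exact diffContOnCl_const
      | cons a l ihl => exact (ih a).add ihl
    exact (this (N x)).const_smul t

lemma green_diffContOnCl (hN : ∀ x, (N x).length ≤ 4) (hs : 0 ≤ s) (hs1 : s < 1) {M : ℝ}
    {φ : ℂ → α → ℂ} (h : ∀ y, DiffContOnCl ℂ (fun z => φ z y) (Metric.ball 0 1))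
    (hM : ∀ z ∈ Metric.closedBall (0 : ℂ) 1, ∀ y, ‖φ z y‖ ≤ M) (x : α) :
    DiffContOnCl ℂ (fun z => green N s (φ z) x) (Metric.ball 0 1) := by
  have hM0 : 0 ≤ M := (norm_nonneg _).trans (hM 0 (by simp) x)
  have hsum : Summable fun n : ℕ => s ^ n * M := (summable_geometric_of_lt_one hs hs1).mul_right M
  have hd := fun n => walkOp_pow_diffContOnCl (N := N) h ((s / 4 : ℝ) : ℂ) n x
  refine ⟨?_, ?_⟩
  · exact Complex.differentiableOn_tsum_of_summable_norm hsum (fun n => (hd n).differentiableOn)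
      Metric.isOpen_ball fun n z hz => norm_walkOp_pow_le_geometric hN hs hM0
        (hM z (Metric.ball_subset_closedBall hz)) n x
  · rw [closure_ball _ one_ne_zero]
    refine continuousOn_tsum (fun n => ?_) hsum fun n z hz =>
      norm_walkOp_pow_le_geometric hN hs hM0 (hM z hz) n x
    have := (hd n).continuousOn
    rwa [closure_ball _ one_ne_zero] at this

end Green

section Graphs

/-- The neighbours inside the three-quadrant cone, folded along the diagonal: the points `(x, y)`
with `|x - y| = 2 * a` and `max x y = b` are represented by `(a, b)`. -/
def foldNbrs : ℕ × ℕ → List (ℕ × ℕ)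
  | (0, 0) => [(0, 1), (1, 1), (1, 1)]
  | (0, b + 1) => [(0, b + 2), (1, b + 2), (1, b + 2), (0, b)]
  | (a + 1, 0) => [(a + 1, 1), (a + 2, 1)]
  | (a + 1, b + 1) => [(a + 1, b + 2), (a + 2, b + 2), (a + 1, b), (a, b)]

/-- The neighbours for Gessel's steps in the quadrant. -/
def gesselNbrs : ℕ × ℕ → List (ℕ × ℕ)
  | (a, 0) => [(a, 1), (a + 1, 1)]
  | (0, b + 1) => [(0, b + 2), (1, b + 2), (0, b)]
  | (a + 1, b + 1) => [(a + 1, b + 2), (a + 2, b + 2), (a + 1, b), (a, b)]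

lemma length_foldNbrs_le (p : ℕ × ℕ) : (foldNbrs p).length ≤ 4 := by
  rcases p with ⟨_ | a, _ | b⟩ <;> simp [foldNbrs]

lemma length_gesselNbrs_le (p : ℕ × ℕ) : (gesselNbrs p).length ≤ 4 := by
  rcases p with ⟨_ | a, _ | b⟩ <;> simp [gesselNbrs]

variable {R : Type*} [CommRing R]

/-- The monomial `z ^ a * w ^ b`. -/
def monoFn (z w : R) (p : ℕ × ℕ) : R := z ^ p.1 * w ^ p.2

/-- The weight of the visits to the diagonal. -/
def diagFn (w : R) (p : ℕ × ℕ) : R := if p.1 = 0 then w ^ p.2 else 0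

/-- The weight of the exits from the folded cone. -/
def edgeFn (z : R) (p : ℕ × ℕ) : R :=
  if p.2 = 0 then (if p.1 = 0 then 1 else z ^ p.1 + z ^ (p.1 - 1)) else 0

/-- The weight of the exits from the quadrant through the vertical axis. -/
def gesselDiagFn (w : R) (p : ℕ × ℕ) : R :=
  if p.1 = 0 then (if p.2 = 0 then 0 else w ^ (p.2 - 1)) else 0

/-- The weight of the exits from the quadrant through the horizontal axis. -/
def gesselEdgeFn (z : R) (p : ℕ × ℕ) : R := if p.2 = 0 then z ^ p.1 else 0

lemma fold_kernel {t κ z w : R} (ht : t * κ = 1) (hK : κ * (z * w) = (1 + z) * (z * w ^ 2 + 1)) :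
    (z * w) • (monoFn z w - walkOp foldNbrs t (monoFn z w))
      = (t * z) • edgeFn z + (-(t * (z ^ 2 * w ^ 2 - 1))) • diagFn w := by
  have h : z * w = t * ((1 + z) * (z * w ^ 2 + 1)) := by rw [← hK, ← mul_assoc, ht, one_mul]
  funext ⟨a, b⟩
  rcases a with _ | a <;> rcases b with _ | b <;>
  simp [foldNbrs, monoFn, diagFn, edgeFn, walkOp_apply]
  · linear_combination h
  · linear_combination w ^ (b + 1) * h
  · linear_combination z ^ (a + 1) * h
  · linear_combination z ^ (a + 1) * w ^ (b + 1) * h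

lemma gessel_kernel {t κ z w : R} (ht : t * κ = 1)
    (hK : κ * (z * w) = (1 + z) * (z * w ^ 2 + 1)) :
    (z * w) • (monoFn z w - walkOp gesselNbrs t (monoFn z w))
      = (t * (1 + z)) • gesselEdgeFn z + (t * w) • gesselDiagFn w := by
  have h : z * w = t * ((1 + z) * (z * w ^ 2 + 1)) := by rw [← hK, ← mul_assoc, ht, one_mul]
  funext ⟨a, b⟩
  rcases a with _ | a <;> rcases b with _ | b <;>
  simp [gesselNbrs, monoFn, gesselDiagFn, gesselEdgeFn, walkOp_apply]
  · linear_combination h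
  · linear_combination w ^ (b + 1) * h
  · linear_combination z ^ (a + 1) * h
  · linear_combination z ^ (a + 1) * w ^ (b + 1) * h

variable {𝕜 : Type*} [RCLike 𝕜] {z w : 𝕜}

lemma norm_monoFn_le (hz : ‖z‖ ≤ 1) (hw : ‖w‖ ≤ 1) (p : ℕ × ℕ) : ‖monoFn z w p‖ ≤ 1 := by
  rw [monoFn, norm_mul, norm_pow, norm_pow]
  exact mul_le_one₀ (pow_le_one₀ (norm_nonneg _) hz) (by positivity)
    (pow_le_one₀ (norm_nonneg _) hw)

lemma norm_diagFn_le (hw : ‖w‖ ≤ 1) (p : ℕ × ℕ) : ‖diagFn w p‖ ≤ 1 := by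
  unfold diagFn
  split_ifs
  · rw [norm_pow]; exact pow_le_one₀ (norm_nonneg _) hw
  · simp

lemma norm_edgeFn_le (hz : ‖z‖ ≤ 1) (p : ℕ × ℕ) : ‖edgeFn z p‖ ≤ 2 := by
  unfold edgeFn
  split_ifs
  · simp
  · refine (norm_add_le _ _).trans ?_
    rw [norm_pow, norm_pow]
    linarith [pow_le_one₀ (n := p.1) (norm_nonneg _) hz,
      pow_le_one₀ (n := p.1 - 1) (norm_nonneg _) hz]
  · simp

lemma norm_gesselDiagFn_le (hw : ‖w‖ ≤ 1) (p : ℕ × ℕ) : ‖gesselDiagFn w p‖ ≤ 1 := by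
  unfold gesselDiagFn
  split_ifs
  · simp
  · rw [norm_pow]; exact pow_le_one₀ (norm_nonneg _) hw
  · simp

lemma norm_gesselEdgeFn_le (hz : ‖z‖ ≤ 1) (p : ℕ × ℕ) : ‖gesselEdgeFn z p‖ ≤ 1 := by
  unfold gesselEdgeFn
  split_ifs
  · rw [norm_pow]; exact pow_le_one₀ (norm_nonneg _) hz
  · simp

lemma diffContOnCl_diagFn (p : ℕ × ℕ) (U : Set ℂ) : DiffContOnCl ℂ (fun w => diagFn w p) U := by
  unfold diagFn
  split_ifs
  · exact (differentiable_id.pow _).diffContOnCl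
  · exact diffContOnCl_const

lemma diffContOnCl_edgeFn (p : ℕ × ℕ) (U : Set ℂ) : DiffContOnCl ℂ (fun w => edgeFn w p) U := by
  unfold edgeFn
  split_ifs
  · exact diffContOnCl_const
  · exact ((differentiable_id.pow _).add (differentiable_id.pow _)).diffContOnCl
  · exact diffContOnCl_const

lemma diffContOnCl_gesselDiagFn (p : ℕ × ℕ) (U : Set ℂ) :
    DiffContOnCl ℂ (fun w => gesselDiagFn w p) U := by
  unfold gesselDiagFn
  split_ifs
  · exact diffContOnCl_const
  · exact (differentiable_id.pow _).diffContOnCl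
  · exact diffContOnCl_const

lemma diffContOnCl_gesselEdgeFn (p : ℕ × ℕ) (U : Set ℂ) :
    DiffContOnCl ℂ (fun w => gesselEdgeFn w p) U := by
  unfold gesselEdgeFn
  split_ifs
  · exact (differentiable_id.pow _).diffContOnCl
  · exact diffContOnCl_const

end Graphs

section FunctionalEquations

variable {s : ℝ}

/-- The generating function of visits to the diagonal, for walks with weight `2/3` at the origin
and `1/3` at `(-2, 0)` and `(0, -2)`. -/
noncomputable def diagGF (s : ℝ) (w : ℂ) : ℂ :=
  2 / 3 * (green foldNbrs s (diagFn w) (0, 0) + green foldNbrs s (diagFn w) (1, 0))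

/-- The generating function of exits from the cone, for walks with weight `2/3` at the origin
and `1/3` at `(-2, 0)` and `(0, -2)`. -/
noncomputable def edgeGF (s : ℝ) (z : ℂ) : ℂ :=
  2 / 3 * (green foldNbrs s (edgeFn z) (0, 0) + green foldNbrs s (edgeFn z) (1, 0))

/-- The generating function of exits through the vertical axis for Gessel's walks. -/
noncomputable def gesselDiagGF (s : ℝ) (w : ℂ) : ℂ := green gesselNbrs s (gesselDiagFn w) (0, 0)

/-- The generating function of exits through the horizontal axis for Gessel's walks. -/
noncomputable def gesselEdgeGF (s : ℝ) (z : ℂ) : ℂ := green gesselNbrs s (gesselEdgeFn z) (0, 0)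

lemma diagGF_diffContOnCl (hs : 0 ≤ s) (hs1 : s < 1) :
    DiffContOnCl ℂ (diagGF s) (Metric.ball 0 1) := by
  have h := green_diffContOnCl length_foldNbrs_le hs hs1 (M := 1) (φ := diagFn)
    (fun p => diffContOnCl_diagFn p _) (fun z hz p => norm_diagFn_le (by simpa using hz) p)
  exact ((h (0, 0)).add (h (1, 0))).const_smul (2 / 3 : ℂ)

lemma edgeGF_diffContOnCl (hs : 0 ≤ s) (hs1 : s < 1) :
    DiffContOnCl ℂ (edgeGF s) (Metric.ball 0 1) := by
  have h := green_diffContOnCl length_foldNbrs_le hs hs1 (M := 2) (φ := edgeFn)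
    (fun p => diffContOnCl_edgeFn p _) (fun z hz p => norm_edgeFn_le (by simpa using hz) p)
  exact ((h (0, 0)).add (h (1, 0))).const_smul (2 / 3 : ℂ)

lemma gesselDiagGF_diffContOnCl (hs : 0 ≤ s) (hs1 : s < 1) :
    DiffContOnCl ℂ (gesselDiagGF s) (Metric.ball 0 1) :=
  green_diffContOnCl length_gesselNbrs_le hs hs1 (M := 1) (φ := gesselDiagFn)
    (fun p => diffContOnCl_gesselDiagFn p _)
    (fun z hz p => norm_gesselDiagFn_le (by simpa using hz) p) _

lemma gesselEdgeGF_diffContOnCl (hs : 0 ≤ s) (hs1 : s < 1) :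
    DiffContOnCl ℂ (gesselEdgeGF s) (Metric.ball 0 1) :=
  green_diffContOnCl length_gesselNbrs_le hs hs1 (M := 1) (φ := gesselEdgeFn)
    (fun p => diffContOnCl_gesselEdgeFn p _)
    (fun z hz p => norm_gesselEdgeFn_le (by simpa using hz) p) _

lemma fold_functional_equation (hs : 0 < s) (hs1 : s < 1) {z w : ℂ} (hz : ‖z‖ ≤ 1) (hw : ‖w‖ ≤ 1)
    (hK : 4 / s * (z * w) = (1 + z) * (z * w ^ 2 + 1)) :
    2 / 3 * (z * w * (1 + z))
      = s / 4 * z * edgeGF s z - s / 4 * (z ^ 2 * w ^ 2 - 1) * diagGF s w := by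
  have hs' : (s : ℂ) ≠ 0 := by exact_mod_cast hs.ne'
  have key : ∀ x, z * w * monoFn z w x = s / 4 * z * green foldNbrs s (edgeFn z) x
      - s / 4 * (z ^ 2 * w ^ 2 - 1) * green foldNbrs s (diagFn w) x := by
    intro x
    have h1 := green_sub_walkOp length_foldNbrs_le hs.le hs1 (norm_monoFn_le hz hw) x
    have h2 := fold_kernel (t := ((s / 4 : ℝ) : ℂ)) (κ := 4 / s) (by push_cast; field_simp) hK
    rw [← h1, ← green_smul]
    erw [h2]
    rw [green_add length_foldNbrs_le hs.le hs1 (M := ‖((s / 4 : ℝ) : ℂ) * z‖ * 2)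
      (M' := ‖(-(((s / 4 : ℝ) : ℂ) * (z ^ 2 * w ^ 2 - 1)))‖ * 1), green_smul, green_smul]
    · push_cast; ring
    · intro y
      rw [Pi.smul_apply, norm_smul]
      exact mul_le_mul_of_nonneg_left (norm_edgeFn_le hz y) (norm_nonneg _)
    · intro y
      rw [Pi.smul_apply, norm_smul]
      exact mul_le_mul_of_nonneg_left (norm_diagFn_le hw y) (norm_nonneg _)
  have h0 := key (0, 0)
  have h1 := key (1, 0)
  simp only [monoFn, pow_zero, pow_one, mul_one] at h0 h1
  rw [edgeGF, diagGF]
  linear_combination 2 / 3 * h0 + 2 / 3 * h1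

lemma gessel_functional_equation (hs : 0 < s) (hs1 : s < 1) {z w : ℂ} (hz : ‖z‖ ≤ 1)
    (hw : ‖w‖ ≤ 1) (hK : 4 / s * (z * w) = (1 + z) * (z * w ^ 2 + 1)) :
    z * w = s / 4 * (1 + z) * gesselEdgeGF s z + s / 4 * w * gesselDiagGF s w := by
  have hs' : (s : ℂ) ≠ 0 := by exact_mod_cast hs.ne'
  have h1 := green_sub_walkOp length_gesselNbrs_le hs.le hs1 (norm_monoFn_le hz hw) (0, 0)
  have h2 := gessel_kernel (t := ((s / 4 : ℝ) : ℂ)) (κ := 4 / s) (by push_cast; field_simp) hK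
  have h3 : z * w * monoFn z w (0, 0) = z * w := by simp [monoFn]
  rw [← h3, ← h1, ← green_smul]
  erw [h2]
  rw [green_add length_gesselNbrs_le hs.le hs1 (M := ‖((s / 4 : ℝ) : ℂ) * (1 + z)‖ * 1)
    (M' := ‖((s / 4 : ℝ) : ℂ) * w‖ * 1), green_smul, green_smul]
  · rw [gesselEdgeGF, gesselDiagGF]
    push_cast; ring
  · intro y
    rw [Pi.smul_apply, norm_smul]
    exact mul_le_mul_of_nonneg_left (norm_gesselEdgeFn_le hz y) (norm_nonneg _)
  · intro y
    rw [Pi.smul_apply, norm_smul]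
    exact mul_le_mul_of_nonneg_left (norm_gesselDiagFn_le hw y) (norm_nonneg _)

end FunctionalEquations

section Curve

/-- The part of the kernel curve lying in the closed unit bidisc. -/
def OnCurve (s : ℝ) (z w : ℂ) : Prop :=
  ‖z‖ ≤ 1 ∧ ‖w‖ ≤ 1 ∧ 4 / s * (z * w) = (1 + z) * (z * w ^ 2 + 1)

lemma exists_add_eq_mul_eq (b q : ℂ) : ∃ x y, x + y = b ∧ x * y = q ∧ ‖x‖ ≤ ‖y‖ := by
  obtain ⟨r, hr⟩ := IsAlgClosed.exists_pow_nat_eq (b ^ 2 - 4 * q) (n := 2) (by norm_num)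
  rcases le_total ‖(b - r) / 2‖ ‖(b + r) / 2‖ with h | h
  · exact ⟨_, _, by ring, by linear_combination (-1 / 4) * hr, h⟩
  · exact ⟨_, _, by ring, by linear_combination (-1 / 4) * hr, h⟩

lemma exists_norm_lt_one_root {b q : ℂ} (hb : 2 < ‖b‖) (hq : ‖q‖ = 1) :
    ∃ x, ‖x‖ < 1 ∧ x ^ 2 - b * x + q = 0 := by
  obtain ⟨x, y, rfl, rfl, h⟩ := exists_add_eq_mul_eq b q
  refine ⟨x, ?_, by ring⟩
  by_contra! hx
  rw [norm_mul] at hq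
  have h1 := norm_add_le x y
  nlinarith

variable {s : ℝ} (hs : 0 < s) (hs1 : s < 1)
include hs hs1

omit hs1 in
lemma norm_kappa : ‖(4 / s : ℂ)‖ = 4 / s := by
  rw [norm_div, Complex.norm_real, Real.norm_of_nonneg hs.le]; norm_num

lemma four_lt_kappa : 4 < 4 / s := by rw [lt_div_iff₀ hs]; linarith

lemma exists_onCurve_of_norm_left {z : ℂ} (hz : ‖z‖ = 1) : ∃ w, ‖w‖ < 1 ∧ OnCurve s z w := by
  rcases eq_or_ne (1 + z) 0 with h | h
  · exact ⟨0, by simp, hz.le, by simp, by simp [h]⟩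
  have hz0 : z ≠ 0 := by rintro rfl; simp at hz
  obtain ⟨w, hw, h2⟩ := exists_norm_lt_one_root (b := 4 / s / (1 + z)) (q := 1 / z) (by
    rw [norm_div, norm_kappa hs, lt_div_iff₀ (norm_pos_iff.2 h)]
    have := norm_add_le 1 z
    rw [norm_one, hz] at this
    linarith [four_lt_kappa hs hs1]) (by rw [norm_div, hz]; simp)
  refine ⟨w, hw, hz.le, hw.le, ?_⟩
  field_simp at h2 ⊢
  linear_combination (-1) * h2

lemma exists_onCurve_of_norm_right {w : ℂ} (hw : ‖w‖ = 1) : ∃ z, ‖z‖ < 1 ∧ OnCurve s z w := by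
  have hw0 : w ≠ 0 := by rintro rfl; simp at hw
  obtain ⟨z, hz, h2⟩ := exists_norm_lt_one_root (b := (4 / s * w - (w ^ 2 + 1)) / w ^ 2)
    (q := 1 / w ^ 2) (by
    rw [norm_div, norm_pow, hw, one_pow, div_one]
    have h1 := norm_sub_norm_le (4 / s * w) (w ^ 2 + 1)
    have h2 := norm_add_le (w ^ 2) 1
    rw [norm_mul, norm_kappa hs, hw] at h1
    rw [norm_pow, hw, norm_one] at h2
    linarith [four_lt_kappa hs hs1]) (by rw [norm_div, norm_pow, hw]; simp)
  refine ⟨z, hz, hz.le, hw.le, ?_⟩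
  field_simp at h2 ⊢
  linear_combination (-1) * h2

lemma exists_onCurve_near {z : ℂ} (hz : ‖z‖ ≤ 1) (hz2 : ‖1 + z‖ ≤ 1 / 2) (hz1 : z ≠ -1) :
    ∃ w, w ≠ 0 ∧ ‖w‖ ≤ ‖1 + z‖ ∧ OnCurve s z w := by
  have h : 1 + z ≠ 0 := fun h => hz1 (by linear_combination h)
  have hzn : 1 / 2 ≤ ‖z‖ := by
    have := norm_sub_norm_le 1 (1 + z)
    rw [show (1 : ℂ) - (1 + z) = -z by ring, norm_neg, norm_one] at this
    linarith
  have hz0 : z ≠ 0 := by rintro rfl; norm_num at hzn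
  obtain ⟨x, y, h1, h2, h3⟩ := exists_add_eq_mul_eq (4 / s / (1 + z)) (1 / z)
  have hx : ‖x‖ ≤ ‖1 + z‖ := by
    have h4 := norm_add_le x y
    rw [h1, norm_div, norm_kappa hs, div_le_iff₀ (norm_pos_iff.2 h)] at h4
    have h5 : ‖x‖ * ‖y‖ ≤ 2 := by
      rw [← norm_mul, h2, norm_div, norm_one, div_le_iff₀ (by linarith)]
      linarith
    have := four_lt_kappa hs hs1
    have h6 : 2 ≤ ‖y‖ * ‖1 + z‖ := by nlinarith [norm_nonneg (1 + z)]
    by_contra! h7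
    have h8 : 0 < ‖1 + z‖ := norm_pos_iff.2 h
    nlinarith [mul_pos (by nlinarith : 0 < ‖y‖) (sub_pos.2 h7)]
  refine ⟨x, ?_, hx, hz, hx.trans (by linarith), ?_⟩
  · rintro rfl
    rw [zero_mul, eq_comm, div_eq_zero_iff] at h2
    simp [hz0] at h2
  · have hx2 : x ^ 2 - 4 / s / (1 + z) * x + 1 / z = 0 := by rw [← h1, ← h2]; ring
    field_simp at hx2 ⊢
    linear_combination (-1) * hx2

lemma eq_const_of_invariant {I B : ℂ → ℂ} (hI : DifferentiableOn ℂ I (ball 0 1))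
    (hIc : ContinuousOn I (closedBall 0 1 \ {-1})) (hB : DiffContOnCl ℂ B (ball 0 1))
    (h : ∀ z w, OnCurve s z w → w ≠ 0 → I z = B w) :
    ∃ c, (∀ w, ‖w‖ ≤ 1 → B w = c) ∧ ∀ z, ‖z‖ ≤ 1 → z ≠ -1 → I z = c := by
  classical
  set J := Function.update I (-1) (B 0) with hJdef
  have hJ1 : J (-1) = B 0 := by simp [hJdef]
  have hJ2 : ∀ z, z ≠ -1 → J z = I z := fun z hz => by simp [hJdef, hz]
  have hcl : closure (ball (0 : ℂ) 1) = closedBall 0 1 := closure_ball _ one_ne_zero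
  have hBc : ContinuousOn B (closedBall 0 1) := hcl ▸ hB.continuousOn
  have hJB : ∀ z w, OnCurve s z w → J z = B w := by
    intro z w hzw
    rcases eq_or_ne w 0 with rfl | hw
    · have : 1 + z = 0 := by simpa using hzw.2.2.symm
      rw [show z = -1 by linear_combination this, hJ1]
    · rw [← h z w hzw hw]
      refine hJ2 _ ?_
      rintro rfl
      have := hzw.2.2
      have hs0 : (s : ℂ) ≠ 0 := by exact_mod_cast hs.ne'
      simp [hs0, hw] at this
  have hJc : ContinuousOn J (closedBall 0 1) := by
    intro z hz
    rcases eq_or_ne z (-1) with rfl | hz1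
    · rw [Metric.continuousWithinAt_iff]
      intro ε hε
      obtain ⟨δ, hδ, hδ2⟩ := Metric.continuousWithinAt_iff.1 (hBc 0 (by simp)) ε hε
      refine ⟨min δ (1 / 2), by positivity, fun {x} hx hxd => ?_⟩
      rw [dist_eq_norm, sub_neg_eq_add, add_comm] at hxd
      rcases eq_or_ne x (-1) with rfl | hx1
      · simpa using hε
      obtain ⟨w, hw0, hw1, hw2⟩ := exists_onCurve_near hs hs1 (by simpa using hx)
        (hxd.le.trans (min_le_right _ _)) hx1
      rw [hJ1, hJB _ _ hw2]
      refine hδ2 (by simpa using hw2.2.1) ?_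
      rw [dist_zero_right]
      exact hw1.trans_lt (hxd.trans_le (min_le_left _ _))
    · have h1 : ContinuousWithinAt I (closedBall 0 1) z := by
        refine (hIc z ⟨hz, hz1⟩).mono_of_mem_nhdsWithin ?_
        exact inter_mem self_mem_nhdsWithin
          (mem_nhdsWithin_of_mem_nhds (isOpen_compl_singleton.mem_nhds hz1))
      refine h1.congr_of_eventuallyEq ?_ (hJ2 z hz1)
      filter_upwards [mem_nhdsWithin_of_mem_nhds (isOpen_compl_singleton.mem_nhds hz1)] with x hx
        using hJ2 x hx
  have hJ : DiffContOnCl ℂ J (ball 0 1) := by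
    refine ⟨hI.congr fun z hz => hJ2 z ?_, hcl ▸ hJc⟩
    rintro rfl
    simp at hz
  have hfr : frontier (ball (0 : ℂ) 1) = sphere 0 1 := frontier_ball _ one_ne_zero
  obtain ⟨w₀, hw₀, hw₀m⟩ := Complex.exists_mem_frontier_isMaxOn_norm isBounded_ball
    (nonempty_ball.2 one_pos) hB
  obtain ⟨z₀, hz₀, hz₀m⟩ := Complex.exists_mem_frontier_isMaxOn_norm isBounded_ball
    (nonempty_ball.2 one_pos) hJ
  rw [hfr, mem_sphere_zero_iff_norm] at hw₀ hz₀
  obtain ⟨z₁, hz₁, hz₁c⟩ := exists_onCurve_of_norm_right hs hs1 hw₀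
  obtain ⟨w₁, hw₁, hw₁c⟩ := exists_onCurve_of_norm_left hs hs1 hz₀
  have e1 := hJB _ _ hz₁c
  have e2 := hJB _ _ hw₁c
  rw [hcl] at hw₀m hz₀m
  have hMB : ∀ w ∈ closedBall (0 : ℂ) 1, ‖B w‖ ≤ ‖B w₀‖ := fun w hw => hw₀m hw
  have hMJ : ∀ w ∈ closedBall (0 : ℂ) 1, ‖J w‖ ≤ ‖J z₀‖ := fun w hw => hz₀m hw
  have a1 := hMB w₁ (by simpa using hw₁.le)
  have a2 := hMJ z₁ (by simpa using hz₁.le)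
  rw [e1] at a2
  rw [← e2] at a1
  have hmB : IsMaxOn (norm ∘ B) (ball 0 1) w₁ := by
    intro w hw
    simp only [mem_ofPred_eq, Function.comp]
    rw [← e2]
    exact (hMB w (ball_subset_closedBall hw)).trans a2
  have hmJ : IsMaxOn (norm ∘ J) (ball 0 1) z₁ := by
    intro w hw
    simp only [mem_ofPred_eq, Function.comp]
    rw [e1]
    exact (hMJ w (ball_subset_closedBall hw)).trans a1
  have k1 := Complex.eqOn_closure_of_isPreconnected_of_isMaxOn_norm
    (convex_ball (0 : ℂ) 1).isPreconnected isOpen_ball hB (by simpa using hw₁) hmB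
  have k2 := Complex.eqOn_closure_of_isPreconnected_of_isMaxOn_norm
    (convex_ball (0 : ℂ) 1).isPreconnected isOpen_ball hJ (by simpa using hz₁) hmJ
  rw [hcl] at k1 k2
  refine ⟨B w₁, fun w hw => k1 (by simpa using hw), fun z hz hz1 => ?_⟩
  rw [← hJ2 z hz1, k2 (by simpa using hz)]
  have q1 := k2 (show (-1 : ℂ) ∈ closedBall 0 1 by simp)
  have q2 := k1 (show (0 : ℂ) ∈ closedBall 0 1 by simp)
  simp only [Function.const_apply] at q1 q2 ⊢
  rw [← q1, hJ1, q2]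

end Curve

section Master

lemma exists_eq_mul_of_zero {f : ℂ → ℂ} (hf : DiffContOnCl ℂ f (ball 0 1)) (h0 : f 0 = 0) :
    ∃ g, DiffContOnCl ℂ g (ball 0 1) ∧ ∀ w, f w = w * g w := by
  have hnhds : ball (0 : ℂ) 1 ∈ 𝓝 0 := ball_mem_nhds _ one_pos
  refine ⟨dslope f 0, ⟨(Complex.differentiableOn_dslope hnhds).2 hf.differentiableOn, ?_⟩,
    fun w => ?_⟩
  · exact (continuousOn_dslope (mem_of_superset hnhds subset_closure)).2
      ⟨hf.continuousOn, hf.differentiableAt isOpen_ball (by simp)⟩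
  · have := sub_smul_dslope f 0 w
    simpa [h0] using this.symm

lemma diffContOnCl_pow {f : ℂ → ℂ} {U : Set ℂ} (hf : DiffContOnCl ℂ f U) (n : ℕ) :
    DiffContOnCl ℂ (fun w => f w ^ n) U :=
  ⟨hf.differentiableOn.pow n, hf.continuousOn.pow n⟩

lemma diffContOnCl_mul {f g : ℂ → ℂ} {U : Set ℂ} (hf : DiffContOnCl ℂ f U)
    (hg : DiffContOnCl ℂ g U) : DiffContOnCl ℂ (fun w => f w * g w) U :=
  ⟨hf.differentiableOn.mul hg.differentiableOn, hf.continuousOn.mul hg.continuousOn⟩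

lemma exists_polar_part {τ : ℂ → ℂ} (hτ : DiffContOnCl ℂ τ (ball 0 1)) (k : ℕ) :
    ∀ A : ℂ → ℂ, DiffContOnCl ℂ A (ball 0 1) → ∃ (P : Polynomial ℂ) (B : ℂ → ℂ),
      P.natDegree ≤ k ∧ P.coeff k = A 0 ∧ DiffContOnCl ℂ B (ball 0 1) ∧
      ∀ w, w ≠ 0 → A w = w ^ k * (P.eval (1 / w + w * τ w) + B w) := by
  induction k with
  | zero =>
    intro A hA
    exact ⟨Polynomial.C (A 0), fun w => A w - A 0, by simp, by simp,
      hA.sub diffContOnCl_const, fun w hw => by simp⟩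
  | succ k ih =>
    intro A hA
    have h1 : DiffContOnCl ℂ (fun w => A w - A 0 * (1 + w ^ 2 * τ w) ^ (k + 1)) (ball 0 1) := by
      refine hA.sub (diffContOnCl_mul diffContOnCl_const (diffContOnCl_pow ?_ _))
      exact diffContOnCl_const.add (diffContOnCl_mul (differentiable_id.pow 2).diffContOnCl hτ)
    obtain ⟨A', hA', hAA⟩ := exists_eq_mul_of_zero h1 (by simp)
    obtain ⟨P, B, hP, hPc, hB, h⟩ := ih A' hA'
    refine ⟨Polynomial.C (A 0) * Polynomial.X ^ (k + 1) + P, B, ?_, ?_, hB, fun w hw => ?_⟩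
    · exact Polynomial.natDegree_add_le_of_degree_le (Polynomial.natDegree_C_mul_X_pow_le _ _)
        (hP.trans (Nat.le_succ k))
    · simp [Polynomial.coeff_eq_zero_of_natDegree_lt (Nat.lt_succ_of_le hP)]
    · have e := hAA w
      rw [h w hw] at e
      have e2 : w ^ (k + 1) * (1 / w + w * τ w) ^ (k + 1) = (1 + w ^ 2 * τ w) ^ (k + 1) := by
        rw [← mul_pow]; congr 1; field_simp
      simp only [Polynomial.eval_add, Polynomial.eval_mul, Polynomial.eval_C,
        Polynomial.eval_pow, Polynomial.eval_X]
      linear_combination e - A 0 * e2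

/-- The invariant of Gessel's walks as a function of the first variable. -/
noncomputable def gesselLeft (s : ℝ) (z : ℂ) : ℂ :=
  4 / s * z / (1 + z) - s / 4 * (1 + z) * gesselEdgeGF s z

/-- The analytic part of the invariant of Gessel's walks as a function of the second variable. -/
noncomputable def gesselRest (s : ℝ) (w : ℂ) : ℂ := s / 4 * gesselDiagGF s w

/-- The invariant of Gessel's walks as a function of the second variable. -/
noncomputable def gesselRight (s : ℝ) (w : ℂ) : ℂ := 1 / w + w * gesselRest s w

variable {s : ℝ} (hs : 0 < s) (hs1 : s < 1)
include hs hs1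

lemma gesselRest_diffContOnCl : DiffContOnCl ℂ (gesselRest s) (ball 0 1) :=
  diffContOnCl_mul diffContOnCl_const (gesselDiagGF_diffContOnCl hs.le hs1)

omit hs1 in
lemma OnCurve.one_add_ne_zero {z w : ℂ} (h : OnCurve s z w) (hw : w ≠ 0) : 1 + z ≠ 0 := by
  intro h1
  have hs0 : (s : ℂ) ≠ 0 := by exact_mod_cast hs.ne'
  have := h.2.2
  rw [h1] at this
  have hz : z = -1 := by linear_combination h1
  simp [hs0, hw, hz] at this

omit hs hs1 in
lemma OnCurve.ne_zero {z w : ℂ} (h : OnCurve s z w) : z ≠ 0 := by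
  rintro rfl
  simpa using h.2.2

lemma gesselLeft_eq_gesselRight {z w : ℂ} (h : OnCurve s z w) (hw : w ≠ 0) :
    gesselLeft s z = gesselRight s w := by
  have h1 := gessel_functional_equation hs hs1 h.1 h.2.1 h.2.2
  have hz1 := h.one_add_ne_zero hs hw
  have h2 : 4 / s * z / (1 + z) = z * w + 1 / w := by
    field_simp
    linear_combination h.2.2
  rw [gesselLeft, gesselRight, gesselRest, h2]
  linear_combination h1

lemma gesselLeft_differentiableOn : DifferentiableOn ℂ (gesselLeft s) (ball 0 1) := by
  refine DifferentiableOn.sub (DifferentiableOn.div (by fun_prop) (by fun_prop) ?_)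
    (DifferentiableOn.mul (by fun_prop) (gesselEdgeGF_diffContOnCl hs.le hs1).differentiableOn)
  intro x hx h
  rw [show x = -1 by linear_combination h] at hx
  simp at hx

lemma gesselLeft_continuousOn : ContinuousOn (gesselLeft s) (closedBall 0 1 \ {-1}) := by
  have hc := (gesselEdgeGF_diffContOnCl hs.le hs1).continuousOn
  rw [closure_ball _ one_ne_zero] at hc
  refine ContinuousOn.sub (ContinuousOn.div (by fun_prop) (by fun_prop) ?_)
    (ContinuousOn.mul (by fun_prop) (hc.mono sdiff_subset))
  intro x hx h
  exact hx.2 (by simpa using (show x = -1 by linear_combination h))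

lemma exists_polynomial_gessel {I A : ℂ → ℂ} {k : ℕ} (hI : DifferentiableOn ℂ I (ball 0 1))
    (hIc : ContinuousOn I (closedBall 0 1 \ {-1})) (hA : DiffContOnCl ℂ A (ball 0 1))
    (h : ∀ z w, OnCurve s z w → w ≠ 0 → w ^ (k + 1) * I z = A w) :
    ∃ P : Polynomial ℂ, P.natDegree ≤ k + 1 ∧ P.coeff (k + 1) = A 0 ∧
      (∀ z, ‖z‖ ≤ 1 → z ≠ -1 → I z = P.eval (gesselLeft s z)) ∧
      ∀ w, ‖w‖ ≤ 1 → w ≠ 0 → A w = w ^ (k + 1) * P.eval (gesselRight s w) := by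
  obtain ⟨P, B, hP, hPc, hB, hAB⟩ := exists_polar_part (gesselRest_diffContOnCl hs hs1) (k + 1) A hA
  obtain ⟨c, h1, h2⟩ := eq_const_of_invariant hs hs1
    (I := fun z => I z - P.eval (gesselLeft s z)) (B := B)
    (hI.sub (P.differentiable.comp_differentiableOn (gesselLeft_differentiableOn hs hs1)))
    (hIc.sub (P.continuous.comp_continuousOn (gesselLeft_continuousOn hs hs1))) hB (by
      intro z w hzw hw
      have e1 := h z w hzw hw
      have e2 := hAB w hw
      rw [← e1] at e2
      have e3 := mul_left_cancel₀ (pow_ne_zero _ hw) e2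
      rw [gesselLeft_eq_gesselRight hs hs1 hzw hw, gesselRight, e3]
      ring)
  refine ⟨P + Polynomial.C c, ?_, ?_, fun z hz hz1 => ?_, fun w hw hw0 => ?_⟩
  · exact Polynomial.natDegree_add_le_of_degree_le hP (by simp)
  · simp [hPc]
  · simp only [Polynomial.eval_add, Polynomial.eval_C, ← h2 z hz hz1]; ring
  · rw [hAB w hw0, h1 w hw]
    simp [gesselRight]

end Master

section Monotone

lemma sum_walkOp_pow_le {α : Type*} {N : α → List α} {t : ℝ} (ht : 0 ≤ t) {ψ h : α → ℝ}
    (h0 : ∀ x, 0 ≤ h x) (hh : ∀ x, ψ x + walkOp N t h x ≤ h x) (n : ℕ) (x : α) :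
    ∑ k ∈ Finset.range n, (walkOp N t ^ k) ψ x ≤ h x := by
  induction n generalizing x with
  | zero => simpa using h0 x
  | succ n ih =>
    rw [Finset.sum_range_succ']
    have h1 : ∑ k ∈ Finset.range n, (walkOp N t ^ (k + 1)) ψ x
        = walkOp N t (∑ k ∈ Finset.range n, (walkOp N t ^ k) ψ) x := by
      simp only [walkOp_pow_succ, map_sum, Finset.sum_apply]
    have h2 : walkOp N t (∑ k ∈ Finset.range n, (walkOp N t ^ k) ψ) x ≤ walkOp N t h x := by
      rw [walkOp_apply, walkOp_apply]
      refine mul_le_mul_of_nonneg_left (List.sum_le_sum fun i _ => ?_) ht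
      simpa using ih i
    rw [h1]
    simp only [pow_zero, Module.End.one_apply]
    linarith [hh x]

lemma sum_gessel_le_one {s : ℝ} (hs : 0 ≤ s) (hs1 : s ≤ 1) (n : ℕ) :
    s / 4 * ∑ k ∈ Finset.range n,
      (walkOp gesselNbrs (s / 4) ^ k) (fun p => if p.1 = 0 then (p.2 : ℝ) else 0) (0, 0) ≤ 1 := by
  have h := sum_walkOp_pow_le (N := gesselNbrs) (t := s / 4) (by positivity)
    (ψ := (s / 4) • fun p : ℕ × ℕ => if p.1 = 0 then (p.2 : ℝ) else 0)
    (h := fun p => (p.2 : ℝ) + 1) (fun p => by positivity) (by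
      rintro ⟨a, b⟩
      rcases a with _ | a <;> rcases b with _ | b <;>
      simp [walkOp_apply, gesselNbrs] <;> nlinarith) n (0, 0)
  simp only [map_smul, Pi.smul_apply, smul_eq_mul, ← Finset.mul_sum] at h
  simpa using h

lemma abs_pow_sub_pow_le_mul {x y : ℝ} (hx : 0 ≤ x) (hx1 : x ≤ 1) (hy : 0 ≤ y) (hy1 : y ≤ 1)
    (n : ℕ) :
    |x ^ n - y ^ n| ≤ |x - y| * n := by
  have h := abs_pow_sub_pow_le (a := x) (b := y) (n := n)
  refine h.trans ?_
  have h1 : max |x| |y| ^ (n - 1) ≤ 1 := by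
    apply pow_le_one₀ (by positivity)
    rw [abs_of_nonneg hx, abs_of_nonneg hy]
    exact max_le hx1 hy1
  have : 0 ≤ |x - y| * (n : ℝ) := by positivity
  nlinarith

variable {s : ℝ} (hs : 0 < s) (hs1 : s < 1)
include hs hs1

lemma norm_mul_gesselRest_sub_le {x y : ℝ} (hx : 0 ≤ x) (hx1 : x ≤ 1) (hy : 0 ≤ y) (hy1 : y ≤ 1) :
    ‖(x : ℂ) * gesselRest s x - y * gesselRest s y‖ ≤ |x - y| := by
  have hS : ∀ u : ℝ, 0 ≤ u → u ≤ 1 → HasSum (fun n => (walkOp gesselNbrs ((s / 4 : ℝ) : ℂ) ^ n)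
      (((s / 4 : ℝ) * u : ℂ) • gesselDiagFn (u : ℂ)) (0, 0)) (u * gesselRest s u) := by
    intro u hu hu1
    have h1 : HasSum (fun n => (walkOp gesselNbrs ((s / 4 : ℝ) : ℂ) ^ n)
        (gesselDiagFn (u : ℂ)) (0, 0)) (gesselDiagGF s u) :=
      (summable_green length_gesselNbrs_le hs.le hs1
        (norm_gesselDiagFn_le (w := (u : ℂ)) (by simpa [abs_of_nonneg hu] using hu1)) (0, 0)).hasSum
    have h2 := h1.mul_left ((s / 4 : ℝ) * u : ℂ)
    have e : (u * gesselRest s u : ℂ) = (s / 4 : ℝ) * u * gesselDiagGF s u := by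
      rw [gesselRest]; push_cast; ring
    rw [e]
    refine h2.congr_fun fun n => ?_
    simp only [map_smul]
    rfl
  have h := ((hS x hx hx1).sub (hS y hy hy1)).tendsto_sum_nat
  refine le_of_tendsto h.norm (Eventually.of_forall fun n => ?_)
  have hφ : ∀ p, ‖(((s / 4 : ℝ) * x : ℂ) • gesselDiagFn (x : ℂ)
      - ((s / 4 : ℝ) * y : ℂ) • gesselDiagFn (y : ℂ)) p‖
      ≤ ((s / 4 * |x - y|) • fun p : ℕ × ℕ => if p.1 = 0 then (p.2 : ℝ) else 0) p := by
    rintro ⟨a, b⟩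
    rcases a with _ | a <;> rcases b with _ | b <;> simp [gesselDiagFn]
    have : (s / 4 * x * x ^ b - s / 4 * y * y ^ b : ℂ)
        = ((s / 4 * (x ^ (b + 1) - y ^ (b + 1)) : ℝ) : ℂ) := by push_cast; ring
    have h4 : 0 < s / 4 := by linarith
    rw [this, Complex.norm_real, Real.norm_eq_abs, abs_mul, abs_of_pos h4, mul_assoc]
    have := abs_pow_sub_pow_le_mul hx hx1 hy hy1 (b + 1)
    push_cast at this
    gcongr
  calc _ ≤ ∑ k ∈ Finset.range n, ‖(walkOp gesselNbrs ((s / 4 : ℝ) : ℂ) ^ k)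
        (((s / 4 : ℝ) * x : ℂ) • gesselDiagFn (x : ℂ)
          - ((s / 4 : ℝ) * y : ℂ) • gesselDiagFn (y : ℂ)) (0, 0)‖ := by
        refine (le_of_eq ?_).trans (norm_sum_le _ _)
        simp only [map_sub, Pi.sub_apply]
    _ ≤ ∑ k ∈ Finset.range n, (walkOp gesselNbrs (s / 4) ^ k)
        ((s / 4 * |x - y|) • fun p : ℕ × ℕ => if p.1 = 0 then (p.2 : ℝ) else 0) (0, 0) :=
        Finset.sum_le_sum fun k _ => norm_walkOp_pow_le (t := s / 4) (by positivity) hφ k _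
    _ = |x - y| * (s / 4 * ∑ k ∈ Finset.range n, (walkOp gesselNbrs (s / 4) ^ k)
        (fun p : ℕ × ℕ => if p.1 = 0 then (p.2 : ℝ) else 0) (0, 0)) := by
        simp only [map_smul, Pi.smul_apply, smul_eq_mul, ← Finset.mul_sum]
        ring
    _ ≤ |x - y| := mul_le_of_le_one_right (abs_nonneg _) (sum_gessel_le_one hs.le hs1.le n)

lemma le_norm_gesselRight_sub {x y : ℝ} (hx : 0 < x) (hx1 : x ≤ 1) (hy : 0 < y) (hy1 : y ≤ 1) :
    (1 / (x * y) - 1) * |x - y| ≤ ‖gesselRight s x - gesselRight s y‖ := by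
  have h1 := norm_mul_gesselRest_sub_le hs hs1 hx.le hx1 hy.le hy1
  have h2 : gesselRight s x - gesselRight s y
      = ((-(1 / (x * y) * (x - y)) : ℝ) : ℂ)
        - -((x : ℂ) * gesselRest s x - y * gesselRest s y) := by
    have : (x : ℂ) ≠ 0 := by exact_mod_cast hx.ne'
    have : (y : ℂ) ≠ 0 := by exact_mod_cast hy.ne'
    rw [gesselRight, gesselRight]
    push_cast
    field_simp
    ring_nf
  have h3 := norm_sub_norm_le (((-(1 / (x * y) * (x - y)) : ℝ) : ℂ))
    (-((x : ℂ) * gesselRest s x - y * gesselRest s y))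
  rw [← h2, norm_neg, Complex.norm_real, Real.norm_eq_abs, abs_neg, abs_mul,
    abs_of_pos (by positivity)] at h3
  linarith

lemma gesselRight_injOn : InjOn (fun x : ℝ => gesselRight s x) (Ioo 0 1) := by
  intro x hx y hy hxy
  by_contra hne
  have h := le_norm_gesselRight_sub hs hs1 hx.1 hx.2.le hy.1 hy.2.le
  simp only at hxy
  rw [hxy, sub_self, norm_zero] at h
  have h1 : 1 < 1 / (x * y) := by
    rw [lt_div_iff₀ (mul_pos hx.1 hy.1)]
    nlinarith [hx.1, hx.2, hy.1, hy.2]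
  nlinarith [abs_pos.2 (sub_ne_zero.2 hne)]

omit hs hs1 in
lemma gesselRight_ofReal (x : ℝ) : ∃ r : ℝ, gesselRight s x = r := by
  have : gesselDiagFn (x : ℂ) = fun p => ((gesselDiagFn x p : ℝ) : ℂ) := by
    funext p
    simp only [gesselDiagFn]
    split_ifs <;> simp
  refine ⟨1 / x + x * (s / 4 * green gesselNbrs s (gesselDiagFn x) (0, 0)), ?_⟩
  rw [gesselRight, gesselRest, gesselDiagGF, this, green_ofReal]
  push_cast
  ring

omit hs hs1 in
lemma gesselLeft_zero_ofReal : ∃ r : ℝ, gesselLeft s 0 = r := by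
  have : gesselEdgeFn (0 : ℂ) = fun p => ((gesselEdgeFn (0 : ℝ) p : ℝ) : ℂ) := by
    funext p
    simp only [gesselEdgeFn]
    split_ifs <;> simp
  refine ⟨-(s / 4 * green gesselNbrs s (gesselEdgeFn (0 : ℝ)) (0, 0)), ?_⟩
  rw [gesselLeft, gesselEdgeGF, this, green_ofReal]
  push_cast
  ring

end Monotone

section Invariants

/-- The exit generating function of the folded cone, corrected by its pole. -/
noncomputable def foldLeft (s : ℝ) (z : ℂ) : ℂ := s / 4 * edgeGF s z - 2 / 3 * (4 / s) / (1 + z)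

/-- The diagonal generating function of the folded cone, corrected by its constant term. -/
noncomputable def foldRight (s : ℝ) (w : ℂ) : ℂ := 2 / 3 + s / 4 * w * diagGF s w

/-- The discriminant of the kernel with respect to the first variable. -/
noncomputable def kernelDisc (s : ℝ) (w : ℂ) : ℂ := (4 / s * w - w ^ 2 - 1) ^ 2 - 4 * w ^ 2

variable {s : ℝ} (hs : 0 < s) (hs1 : s < 1)
include hs hs1

lemma foldLeft_mul {z w : ℂ} (h : OnCurve s z w) (hw : w ≠ 0) :
    foldLeft s z * (z * w) = (z ^ 2 * w ^ 2 - 1) * foldRight s w := by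
  have h1 := fold_functional_equation hs hs1 h.1 h.2.1 h.2.2
  have hz1 := h.one_add_ne_zero hs hw
  have hs0 : (s : ℂ) ≠ 0 := by exact_mod_cast hs.ne'
  have h2 : 2 / 3 * (4 / s) / (1 + z) * (z * w) = 2 / 3 * (z * w ^ 2 + 1) := by
    have h3 := h.2.2
    field_simp at h3 ⊢
    linear_combination h3
  rw [foldLeft, foldRight, sub_mul, h2]
  linear_combination (-w) * h1

omit hs hs1 in
lemma OnCurve.disc {z w : ℂ} (h : OnCurve s z w) :
    z ^ 2 * kernelDisc s w = (z ^ 2 * w ^ 2 - 1) ^ 2 := by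
  have h2 : z * (4 / s * w - w ^ 2 - 1) = z ^ 2 * w ^ 2 + 1 := by linear_combination h.2.2
  rw [kernelDisc]
  linear_combination (z * (4 / s * w - w ^ 2 - 1) + z ^ 2 * w ^ 2 + 1) * h2

lemma foldRight_diffContOnCl : DiffContOnCl ℂ (foldRight s) (ball 0 1) :=
  diffContOnCl_const.add (diffContOnCl_mul (by fun_prop : Differentiable ℂ _).diffContOnCl
    (diagGF_diffContOnCl hs.le hs1))

lemma foldLeft_differentiableOn : DifferentiableOn ℂ (foldLeft s) (ball 0 1) := by
  refine DifferentiableOn.sub (DifferentiableOn.mul (by fun_prop)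
    (edgeGF_diffContOnCl hs.le hs1).differentiableOn) (DifferentiableOn.div (by fun_prop)
    (by fun_prop) ?_)
  intro x hx h
  rw [show x = -1 by linear_combination h] at hx
  simp at hx

lemma foldLeft_continuousOn : ContinuousOn (foldLeft s) (closedBall 0 1 \ {-1}) := by
  have hc := (edgeGF_diffContOnCl hs.le hs1).continuousOn
  rw [closure_ball _ one_ne_zero] at hc
  refine ContinuousOn.sub (ContinuousOn.mul (by fun_prop) (hc.mono sdiff_subset))
    (ContinuousOn.div (by fun_prop) (by fun_prop) ?_)
  intro x hx h
  exact hx.2 (by simpa using (show x = -1 by linear_combination h))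

lemma dslope_differentiableOn :
    DifferentiableOn ℂ (dslope (gesselLeft s) 0) (ball 0 1) :=
  (Complex.differentiableOn_dslope (ball_mem_nhds _ one_pos)).2 (gesselLeft_differentiableOn hs hs1)

lemma dslope_continuousOn : ContinuousOn (dslope (gesselLeft s) 0) (closedBall 0 1 \ {-1}) := by
  have h : closedBall (0 : ℂ) 1 \ {-1} ∈ 𝓝 0 :=
    inter_mem (closedBall_mem_nhds _ one_pos) (isOpen_compl_singleton.mem_nhds (by simp))
  exact (continuousOn_dslope h).2 ⟨gesselLeft_continuousOn hs hs1,
    (gesselLeft_differentiableOn hs hs1).differentiableAt (ball_mem_nhds _ one_pos)⟩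

omit hs hs1 in
lemma mul_dslope_gesselLeft (z : ℂ) :
    z * dslope (gesselLeft s) 0 z = gesselLeft s z - gesselLeft s 0 := by
  simpa using sub_smul_dslope (gesselLeft s) 0 z

lemma mul_mul_dslope_gesselLeft {z w : ℂ} (h : OnCurve s z w) (hw : w ≠ 0) :
    w * (z * dslope (gesselLeft s) 0 z) = 1 + w ^ 2 * gesselRest s w - gesselLeft s 0 * w := by
  rw [mul_dslope_gesselLeft, gesselLeft_eq_gesselRight hs hs1 h hw, gesselRight]
  field_simp

lemma exists_linear_invariant : ∃ α β : ℂ, ∀ w, ‖w‖ ≤ 1 → w ≠ 0 →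
    (2 + 2 * gesselRest s w + 4 / s * w * (1 - gesselRest s w) - w ^ 2 * (1 - gesselRest s w ^ 2))
      * (1 + w ^ 2 * gesselRest s w - gesselLeft s 0 * w) = w * (α * gesselRight s w + β) := by
  have hτ := gesselRest_diffContOnCl hs hs1
  obtain ⟨P, hP, -, -, h⟩ := exists_polynomial_gessel hs hs1 (k := 0)
    (I := fun z => ((1 + z) ^ 4 + (4 / s) ^ 2 * z ^ 2) / (1 + z) ^ 2 * dslope (gesselLeft s) 0 z
      + (gesselLeft s z ^ 2 - 4 / s * gesselLeft s z) * (gesselLeft s z - gesselLeft s 0))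
    (A := fun w => (2 + 2 * gesselRest s w + 4 / s * w * (1 - gesselRest s w)
      - w ^ 2 * (1 - gesselRest s w ^ 2)) * (1 + w ^ 2 * gesselRest s w - gesselLeft s 0 * w))
    (by
      have h1 := dslope_differentiableOn hs hs1
      have h2 := gesselLeft_differentiableOn hs hs1
      refine DifferentiableOn.add (DifferentiableOn.mul (DifferentiableOn.div (by fun_prop)
        (by fun_prop) ?_) h1) (by fun_prop)
      intro x hx h
      rw [show x = -1 by linear_combination pow_eq_zero_iff (two_ne_zero) |>.1 h] at hx
      simp at hx)
    (by
      have h1 := dslope_continuousOn hs hs1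
      have h2 := gesselLeft_continuousOn hs hs1
      refine ContinuousOn.add (ContinuousOn.mul (ContinuousOn.div (by fun_prop)
        (by fun_prop) ?_) h1) (by fun_prop)
      intro x hx h
      exact hx.2 (by
        simpa using (show x = -1 by linear_combination pow_eq_zero_iff (two_ne_zero) |>.1 h)))
    ⟨by have := hτ.differentiableOn; fun_prop, by have := hτ.continuousOn; fun_prop⟩
    (by
      intro z w hzw hw
      have hz1 := hzw.one_add_ne_zero hs hw
      have hz0 := hzw.ne_zero
      have e1 := mul_mul_dslope_gesselLeft hs hs1 hzw hw
      have e2 := mul_dslope_gesselLeft (s := s) z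
      rw [← e1, ← e2, gesselLeft_eq_gesselRight hs hs1 hzw hw, gesselRight]
      have e3 : ((1 + z) ^ 4 + (4 / s) ^ 2 * z ^ 2) / (1 + z) ^ 2
          = z * (4 + (w + 1 / w) * (4 / s - (w + 1 / w))) := by
        have h1 : (4 / s : ℂ) = (1 + z) * (z * w ^ 2 + 1) / (z * w) := by
          rw [eq_div_iff (mul_ne_zero hz0 hw)]; exact hzw.2.2
        rw [h1]
        field_simp
        ring
      rw [e3]
      field_simp
      ring)
  refine ⟨P.coeff 1, P.coeff 0, fun w hw hw0 => ?_⟩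
  have e : P.eval (gesselRight s w) = P.coeff 1 * gesselRight s w + P.coeff 0 := by
    rw [Polynomial.eval_eq_sum_range' (Nat.lt_succ_of_le hP)]
    simp [Finset.sum_range_succ, add_comm]
  rw [h w hw hw0, e, zero_add, pow_one]

lemma exists_quadratic_invariant : ∃ P : Polynomial ℂ, P.natDegree ≤ 2 ∧ P.coeff 2 = 4 / 9 ∧
    (∀ z, ‖z‖ ≤ 1 → z ≠ -1 → foldLeft s z ^ 2 = P.eval (gesselLeft s z)) ∧
    ∀ w, ‖w‖ ≤ 1 → w ≠ 0 →
      kernelDisc s w * foldRight s w ^ 2 = w ^ 2 * P.eval (gesselRight s w) := by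
  have hE := foldRight_diffContOnCl hs hs1
  obtain ⟨P, hP, hP2, h1, h2⟩ := exists_polynomial_gessel hs hs1 (k := 1)
    (I := fun z => foldLeft s z ^ 2) (A := fun w => kernelDisc s w * foldRight s w ^ 2)
    ((foldLeft_differentiableOn hs hs1).pow 2) ((foldLeft_continuousOn hs hs1).pow 2)
    ⟨by have := hE.differentiableOn; unfold kernelDisc; fun_prop,
      by have := hE.continuousOn; unfold kernelDisc; fun_prop⟩
    (by
      intro z w hzw hw
      have e := foldLeft_mul hs hs1 hzw hw
      have e2 := hzw.disc
      have hz0 := hzw.ne_zero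
      refine mul_left_cancel₀ (pow_ne_zero 2 hz0) ?_
      linear_combination (foldLeft s z * (z * w) + (z ^ 2 * w ^ 2 - 1) * foldRight s w) * e
        - foldRight s w ^ 2 * e2)
  refine ⟨P, hP, ?_, h1, h2⟩
  rw [hP2, kernelDisc, foldRight]
  norm_num

lemma exists_quartic_invariant : ∃ Q : Polynomial ℂ, Q.natDegree ≤ 4 ∧
    ∀ w, ‖w‖ ≤ 1 → w ≠ 0 → (1 - w ^ 2) * kernelDisc s w * foldRight s w
      * (1 + w ^ 2 * gesselRest s w - gesselLeft s 0 * w) = w ^ 4 * Q.eval (gesselRight s w) := by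
  have hE := foldRight_diffContOnCl hs hs1
  have hτ := gesselRest_diffContOnCl hs hs1
  obtain ⟨Q, hQ, -, -, h⟩ := exists_polynomial_gessel hs hs1 (k := 3)
    (I := fun z => foldLeft s z * (((1 + z) ^ 4 - (4 / s) ^ 2 * z ^ 2) / (1 + z) ^ 2
      * dslope (gesselLeft s) 0 z))
    (A := fun w => (1 - w ^ 2) * kernelDisc s w * foldRight s w
      * (1 + w ^ 2 * gesselRest s w - gesselLeft s 0 * w))
    (by
      refine (foldLeft_differentiableOn hs hs1).mul (DifferentiableOn.mul
        (DifferentiableOn.div (by fun_prop) (by fun_prop) ?_) (dslope_differentiableOn hs hs1))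
      intro x hx h
      rw [show x = -1 by linear_combination pow_eq_zero_iff (two_ne_zero) |>.1 h] at hx
      simp at hx)
    (by
      refine (foldLeft_continuousOn hs hs1).mul (ContinuousOn.mul
        (ContinuousOn.div (by fun_prop) (by fun_prop) ?_) (dslope_continuousOn hs hs1))
      intro x hx h
      exact hx.2 (by
        simpa using (show x = -1 by linear_combination pow_eq_zero_iff (two_ne_zero) |>.1 h)))
    ⟨by have := hE.differentiableOn; have := hτ.differentiableOn; unfold kernelDisc; fun_prop,
      by have := hE.continuousOn; have := hτ.continuousOn; unfold kernelDisc; fun_prop⟩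
    (by
      intro z w hzw hw
      have e := foldLeft_mul hs hs1 hzw hw
      have e1 := mul_mul_dslope_gesselLeft hs hs1 hzw hw
      have e2 := hzw.disc
      have hz0 := hzw.ne_zero
      have hz1 := hzw.one_add_ne_zero hs hw
      rw [← e1]
      have e3 : ((1 + z) ^ 4 - (4 / s) ^ 2 * z ^ 2) / (1 + z) ^ 2 * w ^ 2
          = (1 - w ^ 2) * (z ^ 2 * w ^ 2 - 1) := by
        have h1 : (4 / s : ℂ) = (1 + z) * (z * w ^ 2 + 1) / (z * w) := by
          rw [eq_div_iff (mul_ne_zero hz0 hw)]; exact hzw.2.2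
        rw [h1]
        field_simp
        ring
      refine mul_left_cancel₀ hz0 ?_
      linear_combination (w ^ 2 * z * dslope (gesselLeft s) 0 z * foldLeft s z) * e3
        + w * dslope (gesselLeft s) 0 z * (1 - w ^ 2) * (z ^ 2 * w ^ 2 - 1) * e
        - w * dslope (gesselLeft s) 0 z * (1 - w ^ 2) * foldRight s w * e2)
  exact ⟨Q, hQ, h⟩

end Invariants

section Factorization

open Polynomial in
lemma exists_eq_mul_of_two_roots {Q : ℂ[X]} {p m : ℂ} (hpm : p ≠ m) {n : ℕ}
    (hQ : Q.natDegree ≤ n + 2) (hp : Q.eval p = 0) (hm : Q.eval m = 0) :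
    ∃ r : ℂ[X], r.natDegree ≤ n ∧ Q = (X - C p) * ((X - C m) * r) := by
  obtain ⟨Q₁, rfl⟩ := dvd_iff_isRoot.2 hp
  have h1 : Q₁.eval m = 0 := by
    rw [eval_mul] at hm
    refine (mul_eq_zero.1 hm).resolve_left ?_
    simpa [sub_eq_zero] using hpm.symm
  obtain ⟨r, rfl⟩ := dvd_iff_isRoot.2 h1
  refine ⟨r, ?_, rfl⟩
  rcases eq_or_ne r 0 with rfl | hr
  · simp
  · rw [natDegree_mul (X_sub_C_ne_zero _) (mul_ne_zero (X_sub_C_ne_zero _) hr),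
      natDegree_mul (X_sub_C_ne_zero _) hr] at hQ
    simp only [natDegree_X_sub_C] at hQ
    omega

lemma eq_or_disc_eq_zero {a₁ b₁ a₂ b₂ x y : ℂ} (h3 : 2 * x = a₁ + a₂)
    (h2 : x ^ 2 + 2 * y = b₁ + b₂ + a₁ * a₂) (h1 : 2 * x * y = a₁ * b₂ + a₂ * b₁)
    (h0 : y ^ 2 = b₁ * b₂) : a₁ = a₂ ∨ (a₁ ^ 2 = 4 * b₁ ∧ a₂ ^ 2 = 4 * b₂) := by
  by_cases hA : a₁ = a₂
  · exact Or.inl hA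
  right
  have hA' : a₁ - a₂ ≠ 0 := sub_ne_zero.2 hA
  obtain rfl : x = (a₁ + a₂) / 2 := by linear_combination h3 / 2
  obtain rfl : y = (b₁ + b₂ + a₁ * a₂ - ((a₁ + a₂) / 2) ^ 2) / 2 := by linear_combination h2 / 2
  have hB : b₁ - b₂ = (a₁ + a₂) / 2 * ((a₁ - a₂) / 2) := by
    refine mul_left_cancel₀ hA' ?_
    linear_combination 2 * h1
  have hS : (b₁ + b₂) / 2 = ((a₁ + a₂) / 2) ^ 2 / 4 + ((a₁ - a₂) / 2) ^ 2 / 4 := by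
    refine mul_left_cancel₀ (pow_ne_zero 2 hA') ?_
    have e : b₁ = b₂ + (a₁ + a₂) / 2 * ((a₁ - a₂) / 2) := by linear_combination hB
    rw [e] at h0 ⊢
    linear_combination (-4) * h0
  constructor
  · linear_combination (-2) * hB - 4 * hS
  · linear_combination 2 * hB - 4 * hS

open Polynomial in
lemma exists_double_roots {c c₁ c₀ d₁ d₀ p m : ℂ} {Q : ℂ[X]} (hpm : p ≠ m)
    (hQ : Q.natDegree ≤ 4) (hp : p ^ 3 + c * p ^ 2 + c₁ * p + c₀ = 0)
    (hm : m ^ 3 + c * m ^ 2 + d₁ * m + d₀ = 0)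
    (h : ∀ x, Q.eval x ^ 2 = 4 / 9 * (x - p) * (x - m) * (x ^ 3 + c * x ^ 2 + c₁ * x + c₀)
      * (x ^ 3 + c * x ^ 2 + d₁ * x + d₀)) :
    ∃ b b', (∀ x, x ^ 3 + c * x ^ 2 + c₁ * x + c₀ = (x - p) * (x - b) ^ 2) ∧
      ∀ x, x ^ 3 + c * x ^ 2 + d₁ * x + d₀ = (x - m) * (x - b') ^ 2 := by
  have hp0 : Q.eval p = 0 := by simpa using h p
  have hm0 : Q.eval m = 0 := by simpa using h m
  obtain ⟨r, hr, rfl⟩ := exists_eq_mul_of_two_roots hpm (n := 2) hQ hp0 hm0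
  set a₁ := c + p with ha₁
  set b₁ := c₁ + p * a₁ with hb₁
  set a₂ := c + m with ha₂
  set b₂ := d₁ + m * a₂ with hb₂
  have hf : ∀ x, x ^ 3 + c * x ^ 2 + c₁ * x + c₀ = (x - p) * (x ^ 2 + a₁ * x + b₁) := by
    intro x; rw [hb₁, ha₁]; linear_combination hp
  have hg : ∀ x, x ^ 3 + c * x ^ 2 + d₁ * x + d₀ = (x - m) * (x ^ 2 + a₂ * x + b₂) := by
    intro x; rw [hb₂, ha₂]; linear_combination hm
  have hr2 : r ^ 2 = C (4 / 9) * (X ^ 2 + C a₁ * X + C b₁) * (X ^ 2 + C a₂ * X + C b₂) := by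
    have : ((X - C p) * (X - C m)) ^ 2 ≠ 0 :=
      pow_ne_zero 2 (mul_ne_zero (X_sub_C_ne_zero _) (X_sub_C_ne_zero _))
    refine mul_left_cancel₀ this (Polynomial.funext fun x => ?_)
    have e := h x
    rw [hf, hg] at e
    simp only [eval_mul, eval_sub, eval_X, eval_C, eval_pow, eval_add] at e ⊢
    linear_combination e
  have hrx : ∀ x, r.eval x = r.coeff 0 + r.coeff 1 * x + r.coeff 2 * x ^ 2 := by
    intro x
    rw [Polynomial.eval_eq_sum_range' (Nat.lt_succ_of_le hr)]
    simp [Finset.sum_range_succ]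
  have key : ∀ x, (r.coeff 0 + r.coeff 1 * x + r.coeff 2 * x ^ 2) ^ 2
      = 4 / 9 * (x ^ 2 + a₁ * x + b₁) * (x ^ 2 + a₂ * x + b₂) := by
    intro x
    have e := congrArg (Polynomial.eval x) hr2
    simp only [eval_mul, eval_X, eval_C, eval_pow, eval_add, hrx] at e
    exact e
  generalize r.coeff 0 = r₀ at key
  generalize r.coeff 1 = r₁ at key
  generalize r.coeff 2 = r₂ at key
  have k0 := key 0
  have k1 := key 1
  have k2 := key (-1)
  have k3 := key 2
  have k4 := key (-2)
  clear_value a₁ a₂ b₁ b₂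
  have q4 : r₂ ^ 2 = 4 / 9 := by
    linear_combination (k3 + k4 - 4 * k1 - 4 * k2 + 6 * k0) / 24
  have q3 : 2 * r₁ * r₂ = 4 / 9 * (a₁ + a₂) := by
    linear_combination (k3 - k4 - 2 * k1 + 2 * k2) / 12
  have q2 : r₁ ^ 2 + 2 * r₀ * r₂ = 4 / 9 * (b₁ + b₂ + a₁ * a₂) := by
    linear_combination (k1 + k2) / 2 - k0 - q4
  have q1 : 2 * r₀ * r₁ = 4 / 9 * (a₁ * b₂ + a₂ * b₁) := by
    linear_combination (k1 - k2) / 2 - q3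
  have q0 : r₀ ^ 2 = 4 / 9 * (b₁ * b₂) := by linear_combination k0
  have hd := eq_or_disc_eq_zero (a₁ := a₁) (b₁ := b₁) (a₂ := a₂) (b₂ := b₂) (x := 9 / 4 * r₁ * r₂)
    (y := 9 / 4 * r₀ * r₂) (by linear_combination (9 / 4 : ℂ) * q3)
    (by linear_combination (9 / 4 : ℂ) * q2 + 81 / 16 * r₁ ^ 2 * q4)
    (by linear_combination (9 / 4 : ℂ) * q1 + 81 / 8 * r₀ * r₁ * q4)
    (by linear_combination (9 / 4 : ℂ) * q0 + 81 / 16 * r₀ ^ 2 * q4)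
  rcases hd with hd | ⟨hd1, hd2⟩
  · exact absurd (by linear_combination hd - ha₁ + ha₂) hpm
  · refine ⟨-a₁ / 2, -a₂ / 2, fun x => ?_, fun x => ?_⟩
    · rw [hf]; linear_combination (-(x - p) / 4) * hd1
    · rw [hg]; linear_combination (-(x - m) / 4) * hd2

end Factorization

section Roots

lemma exists_mem_Ioo_add_inv {v : ℝ} (hv : 2 < v) : ∃ x ∈ Ioo (0 : ℝ) 1, x ^ 2 + 1 = v * x := by
  have h : (0 : ℝ) ∈ Ioo ((1 : ℝ) ^ 2 - v * 1 + 1) (0 ^ 2 - v * 0 + 1) := by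
    constructor <;> norm_num; linarith
  obtain ⟨x, hx, hx0⟩ := intermediate_value_Ioo' (zero_le_one' ℝ)
    (f := fun x => x ^ 2 - v * x + 1) (by fun_prop) h
  exact ⟨x, hx, by simp only at hx0; linarith⟩

lemma cubic_coeff_eq {c c₁ c₀ p b : ℂ}
    (h : ∀ x, x ^ 3 + c * x ^ 2 + c₁ * x + c₀ = (x - p) * (x - b) ^ 2) :
    c = -(p + 2 * b) ∧ c₁ = 2 * p * b + b ^ 2 ∧ c₀ = -(p * b ^ 2) := by
  refine ⟨?_, ?_, ?_⟩
  · linear_combination (h 1 + h (-1) - 2 * h 0) / 2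
  · linear_combination (-h 2 + 8 * h 1 - 8 * h (-1) + h (-2)) / 12
  · linear_combination h 0

variable {s : ℝ} (hs : 0 < s) (hs1 : s < 1)
include hs hs1

lemma gesselRight_continuousAt {x : ℝ} (hx : x ∈ Ioo (0 : ℝ) 1) :
    ContinuousAt (fun x : ℝ => gesselRight s x) x := by
  have h1 : ContinuousAt (gesselRest s) (x : ℂ) :=
    ((gesselRest_diffContOnCl hs hs1).differentiableAt isOpen_ball (by
      simpa [abs_of_pos hx.1] using hx.2)).continuousAt
  have h2 : (x : ℂ) ≠ 0 := by exact_mod_cast hx.1.ne'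
  have h3 : ContinuousAt (gesselRight s) (x : ℂ) :=
    (continuousAt_const.div continuousAt_id h2).add (continuousAt_id.mul h1)
  exact h3.comp (f := fun x : ℝ => (x : ℂ)) Complex.continuous_ofReal.continuousAt

lemma exists_cubic_invariant : ∃ α β : ℂ, ∀ μ w : ℂ, ‖w‖ ≤ 1 → w ≠ 0 →
    w ^ 2 * (gesselRight s w ^ 3 + -(4 / s + gesselLeft s 0) * gesselRight s w ^ 2
        + (μ + 4 / s * gesselLeft s 0 + α) * gesselRight s w + (-(gesselLeft s 0 * μ) + β))
      = (w ^ 2 * (μ - 4) - (w ^ 2 + 1) * (4 / s * w - w ^ 2 - 1))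
        * (gesselRight s w - gesselLeft s 0) := by
  obtain ⟨α, β, h⟩ := exists_linear_invariant hs hs1
  refine ⟨-α, -β, fun μ w hw hw0 => ?_⟩
  have e := h w hw hw0
  have hW : w * gesselRight s w = 1 + w ^ 2 * gesselRest s w := by rw [gesselRight]; field_simp
  generalize gesselRight s w = W at *
  generalize gesselRest s w = τ at *
  generalize gesselLeft s 0 = W₀ at *
  have hN : w ^ 2 * W ^ 2 - 4 / s * w ^ 2 * W + 4 * w ^ 2 + (w ^ 2 + 1) * (4 / s * w - w ^ 2 - 1)
      = w ^ 2 * (2 + 2 * τ + 4 / s * w * (1 - τ) - w ^ 2 * (1 - τ ^ 2)) := by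
    linear_combination (w * W + 1 + w ^ 2 * τ - 4 / s * w) * hW
  have e' : (2 + 2 * τ + 4 / s * w * (1 - τ) - w ^ 2 * (1 - τ ^ 2)) * (W - W₀) = α * W + β := by
    refine mul_left_cancel₀ hw0 ?_
    linear_combination e + (2 + 2 * τ + 4 / s * w * (1 - τ) - w ^ 2 * (1 - τ ^ 2)) * hW
  linear_combination (W - W₀) * hN + w ^ 2 * e'

lemma gesselRight_double_root {α β : ℂ} {x₃ : ℝ} (hx₃ : x₃ ∈ Ioo (0 : ℝ) 1)
    (hv : x₃ ^ 2 + 1 = 4 / s / 2 * x₃)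
    (h : ∀ μ w : ℂ, ‖w‖ ≤ 1 → w ≠ 0 →
    w ^ 2 * (gesselRight s w ^ 3 + -(4 / s + gesselLeft s 0) * gesselRight s w ^ 2
        + (μ + 4 / s * gesselLeft s 0 + α) * gesselRight s w + (-(gesselLeft s 0 * μ) + β))
      = (w ^ 2 * (μ - 4) - (w ^ 2 + 1) * (4 / s * w - w ^ 2 - 1))
        * (gesselRight s w - gesselLeft s 0)) (x : ℂ) :
    x ^ 3 + -(4 / s + gesselLeft s 0) * x ^ 2
        + ((4 + (4 / s) ^ 2 / 4) + 4 / s * gesselLeft s 0 + α) * x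
        + (-(gesselLeft s 0 * (4 + (4 / s) ^ 2 / 4)) + β)
      = (x - ((4 / s + gesselLeft s 0) - 2 * gesselRight s x₃)) * (x - gesselRight s x₃) ^ 2 := by
  set κ : ℂ := 4 / s with hκ
  set W₀ := gesselLeft s 0
  set b := gesselRight s x₃ with hb
  have hv' : (x₃ : ℂ) ^ 2 + 1 = κ / 2 * x₃ := by
    rw [hκ]; exact_mod_cast congrArg (fun r : ℝ => (r : ℂ)) hv
  have hx0 : ∀ x : ℝ, x ∈ Ioo (0 : ℝ) 1 → (x : ℂ) ≠ 0 := fun x hx => by exact_mod_cast hx.1.ne'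
  have hxn : ∀ x : ℝ, x ∈ Ioo (0 : ℝ) 1 → ‖(x : ℂ)‖ ≤ 1 := fun x hx => by
    simpa [abs_of_pos hx.1] using hx.2.le
  set c₁ := (4 + κ ^ 2 / 4) + κ * W₀ + α
  set c₀ := -(W₀ * (4 + κ ^ 2 / 4)) + β
  have hb0 : b ^ 3 + -(κ + W₀) * b ^ 2 + c₁ * b + c₀ = 0 := by
    have e := h (4 + κ ^ 2 / 4) x₃ (hxn _ hx₃) (hx0 _ hx₃)
    refine mul_left_cancel₀ (pow_ne_zero 2 (hx0 _ hx₃)) ?_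
    rw [e]
    linear_combination ((x₃ : ℂ) ^ 2 + 1 - κ / 2 * x₃) * (b - W₀) * hv'
  set q : ℂ → ℂ := fun y => y ^ 2 + (b - (κ + W₀)) * y + (c₁ + b * (b - (κ + W₀))) with hq
  have hfac : ∀ y, y ^ 3 + -(κ + W₀) * y ^ 2 + c₁ * y + c₀ = (y - b) * q y := by
    intro y; simp only [hq]; linear_combination hb0
  have hqb : q b = 0 := by
    have hev : ∀ᶠ x : ℝ in 𝓝[≠] x₃, ‖q (gesselRight s x)‖ * (x ^ 2 * (1 / (x * x₃) - 1))
        ≤ |x - x₃| * ((x - 1 / x₃) ^ 2 * ‖gesselRight s x - W₀‖) := by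
      filter_upwards [mem_nhdsWithin_of_mem_nhds (isOpen_Ioo.mem_nhds hx₃), self_mem_nhdsWithin]
        with x hx hne
      have hne' : x - x₃ ≠ 0 := sub_ne_zero.2 hne
      have e := h (4 + κ ^ 2 / 4) x (hxn _ hx) (hx0 _ hx)
      have e2 : (x : ℂ) ^ 2 * ((gesselRight s x - b) * q (gesselRight s x))
          = (((x - x₃) ^ 2 * (x - 1 / x₃) ^ 2 : ℝ) : ℂ) * (gesselRight s x - W₀) := by
        have e3 : (x : ℂ) ^ 2 * (4 + κ ^ 2 / 4 - 4) - (x ^ 2 + 1) * (κ * x - x ^ 2 - 1)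
            = (((x - x₃) ^ 2 * (x - 1 / x₃) ^ 2 : ℝ) : ℂ) := by
          have : κ = 2 * (x₃ ^ 2 + 1) / x₃ := by
            rw [eq_div_iff (hx0 _ hx₃)]; linear_combination (-2) * hv'
          rw [this]
          push_cast
          have := hx0 _ hx₃
          field_simp
          ring
        rw [← hfac, ← e3]
        exact e
      have e4 := congrArg norm e2
      rw [norm_mul, norm_mul, norm_mul, norm_pow, Complex.norm_real, Complex.norm_real,
        Real.norm_eq_abs, Real.norm_eq_abs, sq_abs,
        abs_of_nonneg (by positivity : 0 ≤ (x - x₃) ^ 2 * (x - 1 / x₃) ^ 2)] at e4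
      have e5 := le_norm_gesselRight_sub hs hs1 hx.1 hx.2.le hx₃.1 hx₃.2.le
      rw [← hb] at e5
      have e6 : 0 < |x - x₃| := abs_pos.2 hne'
      refine le_of_mul_le_mul_left ?_ e6
      calc |x - x₃| * (‖q (gesselRight s x)‖ * (x ^ 2 * (1 / (x * x₃) - 1)))
          = x ^ 2 * (((1 / (x * x₃) - 1) * |x - x₃|) * ‖q (gesselRight s x)‖) := by ring
        _ ≤ x ^ 2 * (‖gesselRight s x - b‖ * ‖q (gesselRight s x)‖) := by gcongr
        _ = |x - x₃| * (|x - x₃| * ((x - 1 / x₃) ^ 2 * ‖gesselRight s x - W₀‖)) := by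
          rw [e4, ← sq_abs (x - x₃)]; ring
    have hc := gesselRight_continuousAt hs hs1 hx₃
    have hqc : ContinuousAt (fun x : ℝ => q (gesselRight s x)) x₃ := by
      simp only [hq]; fun_prop
    have hx30 := hx₃.1.ne'
    have t1 : ContinuousAt (fun x : ℝ => ‖q (gesselRight s x)‖ * (x ^ 2 * (1 / (x * x₃) - 1)))
        x₃ := by
      have : x₃ * x₃ ≠ 0 := mul_ne_zero hx30 hx30
      fun_prop (disch := assumption)
    have t2 : ContinuousAt (fun x : ℝ => |x - x₃| * ((x - 1 / x₃) ^ 2 * ‖gesselRight s x - W₀‖))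
        x₃ := by fun_prop
    have hle := le_of_tendsto_of_tendsto (t1.tendsto.mono_left nhdsWithin_le_nhds)
      (t2.tendsto.mono_left nhdsWithin_le_nhds) hev
    rw [sub_self, abs_zero, zero_mul] at hle
    have hpos : 0 < x₃ ^ 2 * (1 / (x₃ * x₃) - 1) := by
      have : x₃ ^ 2 * (1 / (x₃ * x₃) - 1) = 1 - x₃ ^ 2 := by field_simp
      rw [this]
      nlinarith [hx₃.1, hx₃.2]
    have := nonpos_of_mul_nonpos_left hle hpos
    exact norm_le_zero_iff.1 this
  rw [hfac]
  simp only [hq] at hqb ⊢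
  linear_combination (x - b) * hqb

end Roots

section Parameters

variable {s : ℝ} (hs : 0 < s) (hs1 : s < 1)
include hs hs1

lemma mul_eval_eq_sq {P Q : Polynomial ℂ} {α β : ℂ}
    (hf : ∀ μ w : ℂ, ‖w‖ ≤ 1 → w ≠ 0 →
    w ^ 2 * (gesselRight s w ^ 3 + -(4 / s + gesselLeft s 0) * gesselRight s w ^ 2
        + (μ + 4 / s * gesselLeft s 0 + α) * gesselRight s w + (-(gesselLeft s 0 * μ) + β))
      = (w ^ 2 * (μ - 4) - (w ^ 2 + 1) * (4 / s * w - w ^ 2 - 1))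
        * (gesselRight s w - gesselLeft s 0))
    (hP : ∀ w, ‖w‖ ≤ 1 → w ≠ 0 →
      kernelDisc s w * foldRight s w ^ 2 = w ^ 2 * P.eval (gesselRight s w))
    (hQ : ∀ w, ‖w‖ ≤ 1 → w ≠ 0 → (1 - w ^ 2) * kernelDisc s w * foldRight s w
      * (1 + w ^ 2 * gesselRest s w - gesselLeft s 0 * w) = w ^ 4 * Q.eval (gesselRight s w))
    (x : ℂ) :
    Q.eval x ^ 2 = P.eval x * (x ^ 3 + -(4 / s + gesselLeft s 0) * x ^ 2
        + (2 * (4 / s) + 4 / s * gesselLeft s 0 + α) * x + (-(gesselLeft s 0 * (2 * (4 / s))) + β))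
      * (x ^ 3 + -(4 / s + gesselLeft s 0) * x ^ 2
        + (-(2 * (4 / s)) + 4 / s * gesselLeft s 0 + α) * x
        + (-(gesselLeft s 0 * (-(2 * (4 / s)))) + β)) := by
  have key : Q ^ 2 = P * (.X ^ 3 + .C (-(4 / s + gesselLeft s 0)) * .X ^ 2
        + .C (2 * (4 / s) + 4 / s * gesselLeft s 0 + α) * .X
        + .C (-(gesselLeft s 0 * (2 * (4 / s))) + β))
      * (.X ^ 3 + .C (-(4 / s + gesselLeft s 0)) * .X ^ 2
        + .C (-(2 * (4 / s)) + 4 / s * gesselLeft s 0 + α) * .X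
        + .C (-(gesselLeft s 0 * (-(2 * (4 / s)))) + β)) := by
    have hinf : (((fun x : ℝ => gesselRight s x) '' Ioo (0 : ℝ) 1)).Infinite :=
      (Ioo_infinite zero_lt_one).image (gesselRight_injOn hs hs1)
    refine Polynomial.eq_of_infinite_eval_eq _ _ (hinf.mono ?_)
    rintro _ ⟨r, hr, rfl⟩
    have hw0 : (r : ℂ) ≠ 0 := by exact_mod_cast hr.1.ne'
    have hw : ‖(r : ℂ)‖ ≤ 1 := by simpa [abs_of_pos hr.1] using hr.2.le
    have e1 := hf (2 * (4 / s)) r hw hw0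
    have e2 := hf (-(2 * (4 / s))) r hw hw0
    have e3 := hP r hw hw0
    have e4 := hQ r hw hw0
    have hW : (r : ℂ) * gesselRight s r = 1 + r ^ 2 * gesselRest s r := by
      rw [gesselRight]; field_simp
    simp only [mem_ofPred_eq, Polynomial.eval_mul, Polynomial.eval_pow, Polynomial.eval_add,
      Polynomial.eval_C, Polynomial.eval_X]
    rw [← hW] at e4
    rw [kernelDisc] at e3 e4
    generalize gesselRight s r = W at *
    generalize Polynomial.eval W P = p at *
    generalize Polynomial.eval W Q = q at *
    generalize (r : ℂ) = w at *
    generalize foldRight s w = E at *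
    generalize gesselLeft s 0 = W₀ at *
    generalize (4 : ℂ) / s = κ at *
    set F := W ^ 3 + -(κ + W₀) * W ^ 2 + (2 * κ + κ * W₀ + α) * W + (-(W₀ * (2 * κ)) + β)
    set G := W ^ 3 + -(κ + W₀) * W ^ 2 + (-(2 * κ) + κ * W₀ + α) * W + (-(W₀ * -(2 * κ)) + β)
    refine mul_left_cancel₀ (pow_ne_zero 8 hw0) ?_
    have e5 : w ^ 4 * (F * G) = (W - W₀) ^ 2 * (1 - w ^ 2) ^ 2
        * ((κ * w - w ^ 2 - 1) ^ 2 - 4 * w ^ 2) := by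
      linear_combination w ^ 2 * G * e1
        + (w ^ 2 * (2 * κ - 4) - (w ^ 2 + 1) * (κ * w - w ^ 2 - 1)) * (W - W₀) * e2
    have e6 := congrArg (· ^ 2) e4
    linear_combination -e6 - w ^ 4 * p * e5
      + ((W - W₀) ^ 2 * (1 - w ^ 2) ^ 2 * ((κ * w - w ^ 2 - 1) ^ 2 - 4 * w ^ 2)) * w ^ 2 * e3
  have := congrArg (Polynomial.eval x) key
  simpa only [mem_ofPred_eq, Polynomial.eval_mul, Polynomial.eval_pow, Polynomial.eval_add,
      Polynomial.eval_C, Polynomial.eval_X] using this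

lemma exists_parameters : ∃ W₀ Up Um U₃ bp bm b₃ : ℝ,
    4 / s + W₀ = Up + 2 * bp ∧ 4 / s + W₀ = Um + 2 * bm ∧ 4 / s + W₀ = U₃ + 2 * b₃ ∧
    4 * (4 / s) = (2 * Up * bp + bp ^ 2) - (2 * Um * bm + bm ^ 2) ∧
    W₀ * (4 * (4 / s)) = Up * bp ^ 2 - Um * bm ^ 2 ∧
    4 + (4 / s) ^ 2 / 4 - 2 * (4 / s) = (2 * U₃ * b₃ + b₃ ^ 2) - (2 * Up * bp + bp ^ 2) ∧
    W₀ * (4 + (4 / s) ^ 2 / 4 - 2 * (4 / s)) = U₃ * b₃ ^ 2 - Up * bp ^ 2 ∧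
    foldLeft s 1 ^ 2 = ((4 / 9 * (b₃ - Up) * (b₃ - Um) : ℝ) : ℂ) := by
  obtain ⟨α, β, hf⟩ := exists_cubic_invariant hs hs1
  obtain ⟨P, hP, hP2, hPl, hPr⟩ := exists_quadratic_invariant hs hs1
  obtain ⟨Q, hQ, hQr⟩ := exists_quartic_invariant hs hs1
  have hκ := four_lt_kappa hs hs1
  obtain ⟨xp, hxp, ep⟩ := exists_mem_Ioo_add_inv (v := 4 / s - 2) (by linarith)
  obtain ⟨xm, hxm, em⟩ := exists_mem_Ioo_add_inv (v := 4 / s + 2) (by linarith)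
  obtain ⟨x₃, hx₃, e₃⟩ := exists_mem_Ioo_add_inv (v := 4 / s / 2) (by linarith)
  have hx0 : ∀ x : ℝ, x ∈ Ioo (0 : ℝ) 1 → (x : ℂ) ≠ 0 := fun x hx => by exact_mod_cast hx.1.ne'
  have hxn : ∀ x : ℝ, x ∈ Ioo (0 : ℝ) 1 → ‖(x : ℂ)‖ ≤ 1 := fun x hx => by
    simpa [abs_of_pos hx.1] using hx.2.le
  have hne : gesselRight s xp ≠ gesselRight s xm := by
    intro h
    have := gesselRight_injOn hs hs1 hxp hxm h
    subst this
    nlinarith [hxp.1]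
  have cp : (xp : ℂ) ^ 2 + 1 = (4 / s - 2) * xp := by
    exact_mod_cast congrArg (fun r : ℝ => (r : ℂ)) ep
  have cm : (xm : ℂ) ^ 2 + 1 = (4 / s + 2) * xm := by
    exact_mod_cast congrArg (fun r : ℝ => (r : ℂ)) em
  have c₃ : (x₃ : ℂ) ^ 2 + 1 = 4 / s / 2 * x₃ := by
    exact_mod_cast congrArg (fun r : ℝ => (r : ℂ)) e₃
  have Pp : P.eval (gesselRight s xp) = 0 := by
    have e := hPr xp (hxn _ hxp) (hx0 _ hxp)
    refine (mul_eq_zero.1 (e.symm.trans ?_)).resolve_left (pow_ne_zero 2 (hx0 _ hxp))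
    rw [kernelDisc]
    linear_combination (-(4 / s * xp - xp ^ 2 - 1 + 2 * xp)) * foldRight s xp ^ 2 * cp
  have Pm : P.eval (gesselRight s xm) = 0 := by
    have e := hPr xm (hxn _ hxm) (hx0 _ hxm)
    refine (mul_eq_zero.1 (e.symm.trans ?_)).resolve_left (pow_ne_zero 2 (hx0 _ hxm))
    rw [kernelDisc]
    linear_combination (-(4 / s * xm - xm ^ 2 - 1 - 2 * xm)) * foldRight s xm ^ 2 * cm
  have hPx : ∀ x, P.eval x = 4 / 9 * (x - gesselRight s xp) * (x - gesselRight s xm) := by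
    obtain ⟨r, hr, rfl⟩ := exists_eq_mul_of_two_roots hne (n := 0) hP Pp Pm
    rw [Polynomial.eq_C_of_natDegree_le_zero hr] at hP2 ⊢
    generalize gesselRight s xp = A at *
    generalize gesselRight s xm = B at *
    have : r.coeff 0 = 4 / 9 := by
      rw [← hP2]
      have : (Polynomial.X - Polynomial.C A) * ((Polynomial.X - Polynomial.C B)
          * Polynomial.C (r.coeff 0)) = Polynomial.C (r.coeff 0) * Polynomial.X ^ 2
          + Polynomial.C (-(r.coeff 0 * (A + B))) * Polynomial.X + Polynomial.C (r.coeff 0 * A * B)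
          := by simp only [map_neg, map_mul, map_add]; ring
      rw [this]; simp
    intro x
    rw [this]
    simp only [Polynomial.eval_mul, Polynomial.eval_sub, Polynomial.eval_X, Polynomial.eval_C]
    ring
  have fp := hf (2 * (4 / s)) xp (hxn _ hxp) (hx0 _ hxp)
  have fm := hf (-(2 * (4 / s))) xm (hxn _ hxm) (hx0 _ hxm)
  obtain ⟨b, b', hb, hb'⟩ := exists_double_roots hne hQ
    (c := -(4 / s + gesselLeft s 0)) (c₁ := 2 * (4 / s) + 4 / s * gesselLeft s 0 + α)
    (c₀ := -(gesselLeft s 0 * (2 * (4 / s))) + β)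
    (d₁ := -(2 * (4 / s)) + 4 / s * gesselLeft s 0 + α)
    (d₀ := -(gesselLeft s 0 * (-(2 * (4 / s)))) + β)
    (by
      refine mul_left_cancel₀ (pow_ne_zero 2 (hx0 _ hxp)) (fp.trans ?_)
      linear_combination (xp ^ 2 + 1 - 2 * xp) * (gesselRight s xp - gesselLeft s 0) * cp)
    (by
      refine mul_left_cancel₀ (pow_ne_zero 2 (hx0 _ hxm)) (fm.trans ?_)
      linear_combination (xm ^ 2 + 1 + 2 * xm) * (gesselRight s xm - gesselLeft s 0) * cm)
    (fun x => by rw [mul_eval_eq_sq hs hs1 hf hPr hQr, hPx])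
  have hd := gesselRight_double_root hs hs1 hx₃ e₃ hf
  obtain ⟨p1, p2, p3⟩ := cubic_coeff_eq hb
  obtain ⟨m1, m2, m3⟩ := cubic_coeff_eq hb'
  obtain ⟨d1, d2, d3⟩ := cubic_coeff_eq hd
  obtain ⟨W₀, hW₀⟩ := gesselLeft_zero_ofReal (s := s)
  obtain ⟨Up, hUp⟩ := gesselRight_ofReal (s := s) xp
  obtain ⟨Um, hUm⟩ := gesselRight_ofReal (s := s) xm
  obtain ⟨b₃, hb₃⟩ := gesselRight_ofReal (s := s) x₃
  have h1 : gesselLeft s 1 = gesselRight s x₃ := by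
    refine gesselLeft_eq_gesselRight hs hs1 (z := 1) (w := x₃) ⟨by simp, hxn _ hx₃, ?_⟩ (hx0 _ hx₃)
    linear_combination (-2) * c₃
  have h2 := hPl 1 (by simp) (by norm_num)
  rw [h1, hPx] at h2
  rw [hW₀, hUp] at p1 p2 p3
  rw [hW₀, hUm] at m1 m2 m3
  rw [hW₀, hb₃] at d1 d2 d3
  obtain rfl : b = (((4 / s + W₀ - Up) / 2 : ℝ) : ℂ) := by
    push_cast; linear_combination (1 / 2) * p1
  obtain rfl : b' = (((4 / s + W₀ - Um) / 2 : ℝ) : ℂ) := by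
    push_cast; linear_combination (1 / 2) * m1
  refine ⟨W₀, Up, Um, 4 / s + W₀ - 2 * b₃, (4 / s + W₀ - Up) / 2, (4 / s + W₀ - Um) / 2, b₃,
    by ring, by ring, by ring, ?_, ?_, ?_, ?_, ?_⟩
  · apply Complex.ofReal_injective; push_cast at *; linear_combination p2 - m2
  · apply Complex.ofReal_injective; push_cast at *; linear_combination m3 - p3
  · apply Complex.ofReal_injective; push_cast at *; linear_combination d2 - p2
  · apply Complex.ofReal_injective; push_cast at *; linear_combination p3 - d3
  · rw [h2, hUp, hUm, hb₃]; push_cast; rfl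

end Parameters

section Uniformization

lemma sum_eq_of_cubic_eq {σ a b c : ℝ} (hab : a ≠ b) (hac : a ≠ c) (hbc : b ≠ c)
    (h1 : (σ - a) * a ^ 2 = (σ - b) * b ^ 2) (h2 : (σ - a) * a ^ 2 = (σ - c) * c ^ 2) :
    a + b + c = σ ∧ a * b + a * c + b * c = 0 := by
  have e1 : σ * (a + b) = a ^ 2 + a * b + b ^ 2 := by
    refine mul_left_cancel₀ (sub_ne_zero.2 hab) ?_
    linear_combination h1
  have e2 : σ * (a + c) = a ^ 2 + a * c + c ^ 2 := by
    refine mul_left_cancel₀ (sub_ne_zero.2 hac) ?_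
    linear_combination h2
  have e3 : a + b + c = σ := by
    refine mul_left_cancel₀ (sub_ne_zero.2 hbc) ?_
    linear_combination e2 - e1
  refine ⟨e3, ?_⟩
  rw [← e3] at e1
  linear_combination e1

lemma exists_uniformization {κ W₀ Up Um U₃ bp bm b₃ : ℝ} (hκ : 4 < κ)
    (h1 : κ + W₀ = Up + 2 * bp) (h2 : κ + W₀ = Um + 2 * bm) (h3 : κ + W₀ = U₃ + 2 * b₃)
    (h4 : 4 * κ = (2 * Up * bp + bp ^ 2) - (2 * Um * bm + bm ^ 2))
    (h5 : W₀ * (4 * κ) = Up * bp ^ 2 - Um * bm ^ 2)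
    (h6 : 4 + κ ^ 2 / 4 - 2 * κ = (2 * U₃ * b₃ + b₃ ^ 2) - (2 * Up * bp + bp ^ 2))
    (h7 : W₀ * (4 + κ ^ 2 / 4 - 2 * κ) = U₃ * b₃ ^ 2 - Up * bp ^ 2) :
    ∃ M η : ℝ, 0 < η ∧ η < 1 ∧ 64 * κ = M * (1 - η) * (3 + η) ^ 3 ∧
      (κ - 4) ^ 2 / 4 = M * η ^ 3 ∧
      4 / 9 * (b₃ - Up) * (b₃ - Um) = M * η * (1 + η) * (3 - η) / 9 := by
  obtain rfl : Up = κ + W₀ - 2 * bp := by linarith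
  obtain rfl : Um = κ + W₀ - 2 * bm := by linarith
  obtain rfl : U₃ = κ + W₀ - 2 * b₃ := by linarith
  obtain ⟨σ, rfl⟩ : ∃ σ, κ = 2 * σ + 2 * W₀ := ⟨(κ - 2 * W₀) / 2, by ring⟩
  obtain ⟨a, rfl⟩ : ∃ a, bp = a + W₀ := ⟨bp - W₀, by ring⟩
  obtain ⟨b, rfl⟩ : ∃ b, bm = b + W₀ := ⟨bm - W₀, by ring⟩
  obtain ⟨c, rfl⟩ : ∃ c, b₃ = c + W₀ := ⟨b₃ - W₀, by ring⟩
  have k1 : 4 * (2 * σ + 2 * W₀) = (b - a) * (3 * (a + b) - 4 * σ) := by linear_combination h4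
  have k2 : 4 + (2 * σ + 2 * W₀) ^ 2 / 4 - 2 * (2 * σ + 2 * W₀)
      = (a - c) * (3 * (a + c) - 4 * σ) := by
    linear_combination h6
  have hab : a ≠ b := by
    rintro rfl
    rw [sub_self, zero_mul] at k1
    linarith
  have hac : a ≠ c := by
    rintro rfl
    rw [sub_self, zero_mul] at k2
    nlinarith
  have hbc : b ≠ c := by
    rintro rfl
    nlinarith
  obtain ⟨e1, e2⟩ := sum_eq_of_cubic_eq (σ := σ) hab hac hbc
    (by linear_combination (W₀ * h4 - h5) / 2)
    (by linear_combination (h7 - W₀ * h6) / 2)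
  have hm : a + c ≠ 0 := by
    intro h
    have : c = -a := by linarith
    subst this
    have : a = 0 := by
      have : a ^ 2 = 0 := by linear_combination (-1 : ℝ) * e2
      exact pow_eq_zero_iff two_ne_zero |>.1 this
    simp [this] at hac
  obtain ⟨m, hm_eq⟩ : ∃ m, m = a + c := ⟨_, rfl⟩
  obtain ⟨η, hη⟩ : ∃ η, c - a = η * m := ⟨(c - a) / (a + c), by rw [hm_eq]; field_simp⟩
  rw [← hm_eq] at hm
  obtain rfl : a = m * (1 - η) / 2 := by linear_combination (1 / 2) * (-hη - hm_eq)
  obtain rfl : c = m * (1 + η) / 2 := by linear_combination (1 / 2) * (hη - hm_eq)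
  obtain rfl : b = -(m * (1 - η ^ 2) / 4) := by
    refine mul_left_cancel₀ hm ?_
    linear_combination e2
  have e3 : σ = m * (3 + η ^ 2) / 4 := by linear_combination -e1
  have r1 : 64 * (2 * σ + 2 * W₀) = m ^ 2 * (1 - η) * (3 + η) ^ 3 := by
    rw [e3] at k1
    rw [e3]
    linear_combination 16 * k1
  have r2 : (2 * σ + 2 * W₀ - 4) ^ 2 / 4 = m ^ 2 * η ^ 3 := by
    rw [e3] at k2
    rw [e3]
    linear_combination k2
  have hm2 : 0 < m ^ 2 := by positivity
  have hη0 : 0 < η := by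
    have hκ' : 0 < 2 * σ + 2 * W₀ - 4 := by linarith
    have : 0 < m ^ 2 * η ^ 3 := by rw [← r2]; positivity
    have := pos_of_mul_pos_right this hm2.le
    exact (Odd.pow_pos_iff (by decide)).1 this
  refine ⟨m ^ 2, η, hη0, ?_, r1, r2, ?_⟩
  · have : 0 < m ^ 2 * (3 + η) ^ 3 * (1 - η) := by
      rw [mul_right_comm, ← r1]; linarith
    have := pos_of_mul_pos_right this (by positivity)
    linarith
  · rw [e3]; ring

lemma uniformization_bounds {κ M η : ℝ} (hκ : 4 < κ) (h0 : 0 < η) (h1 : η < 1)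
    (h : 64 * κ = M * (1 - η) * (3 + η) ^ 3) (h' : (κ - 4) ^ 2 / 4 = M * η ^ 3) :
    η ^ 3 ≤ (κ - 4) ^ 2 / 16 := by
  have hM : 0 < M := by
    by_contra! hM
    have : M * (1 - η) * (3 + η) ^ 3 ≤ 0 :=
      mul_nonpos_of_nonpos_of_nonneg (mul_nonpos_of_nonpos_of_nonneg hM (by linarith))
        (by positivity)
    linarith
  have h2 : κ ≤ M := by
    have : M * (1 - η) * (3 + η) ^ 3 ≤ M * 1 * 4 ^ 3 := by gcongr <;> linarith
    linarith
  nlinarith [pow_pos h0 3]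

variable {s : ℝ} (hs : 0 < s) (hs1 : s < 1)
include hs hs1

lemma exists_foldLeft_one : ∃ M η : ℝ, 0 < η ∧ η < 1 ∧ 64 * (4 / s) = M * (1 - η) * (3 + η) ^ 3 ∧
    (4 / s - 4) ^ 2 / 4 = M * η ^ 3 ∧
    foldLeft s 1 ^ 2 = ((M * η * (1 + η) * (3 - η) / 9 : ℝ) : ℂ) := by
  obtain ⟨W₀, Up, Um, U₃, bp, bm, b₃, h1, h2, h3, h4, h5, h6, h7, h8⟩ := exists_parameters hs hs1
  obtain ⟨M, η, k1, k2, k3, k4, k5⟩ :=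
    exists_uniformization (four_lt_kappa hs hs1) h1 h2 h3 h4 h5 h6 h7
  exact ⟨M, η, k1, k2, k3, k4, by rw [h8, k5]⟩

end Uniformization

section Counting

/-- The walks of length `n` from `a` with steps in `S` staying in `R`. -/
abbrev Walks (S R : Set (ℤ × ℤ)) (a : ℤ × ℤ) (n : ℕ) : Type :=
  {w : Fin (n + 1) → ℤ × ℤ // w 0 = a ∧ (∀ k : Fin n, w k.succ - w k.castSucc ∈ S) ∧ ∀ k, w k ∈ R}

variable {S R : Set (ℤ × ℤ)} {a : ℤ × ℤ}

lemma cons_mem_walks (ha : a ∈ R) {n : ℕ} {e : ℤ × ℤ} (he : e ∈ S) (w : Walks S R (a + e) n) :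
    (Fin.cons a w.1 : Fin (n + 2) → ℤ × ℤ) 0 = a ∧
      (∀ k : Fin (n + 1), (Fin.cons a w.1 : Fin (n + 2) → ℤ × ℤ) k.succ
        - (Fin.cons a w.1 : Fin (n + 2) → ℤ × ℤ) k.castSucc ∈ S) ∧
      ∀ k, (Fin.cons a w.1 : Fin (n + 2) → ℤ × ℤ) k ∈ R := by
  obtain ⟨w, h0, h1, h2⟩ := w
  refine ⟨rfl, fun k => ?_, fun k => ?_⟩
  · refine Fin.cases ?_ (fun k => ?_) k
    · simpa [h0] using he
    · simpa [← Fin.succ_castSucc] using h1 k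
  · refine Fin.cases ?_ (fun k => ?_) k
    · simpa using ha
    · simpa using h2 k

lemma walks_cons_bijective (ha : a ∈ R) (n : ℕ) :
    Function.Bijective (fun x : Σ e : S, Walks S R (a + e) n =>
      (⟨Fin.cons a x.2.1, cons_mem_walks ha x.1.2 x.2⟩ : Walks S R a (n + 1))) := by
  constructor
  · rintro ⟨⟨e, he⟩, w, hw⟩ ⟨⟨e', he'⟩, w', hw'⟩ h
    have h1 : w = w' := by
      have := congrArg Subtype.val h
      exact (Fin.cons_injective2 (α := fun _ => ℤ × ℤ) this).2
    subst h1
    obtain rfl : e = e' := add_left_cancel (hw.1.symm.trans hw'.1)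
    rfl
  · rintro ⟨w, h0, h1, h2⟩
    refine ⟨⟨⟨w 1 - a, by simpa [h0] using h1 0⟩, Fin.tail w, ?_, fun k => ?_, fun k => h2 _⟩, ?_⟩
    · simp [Fin.tail]
    · exact h1 k.succ
    · refine Subtype.ext ?_
      change (Fin.cons a (Fin.tail w) : Fin (n + 2) → ℤ × ℤ) = w
      rw [← h0, Fin.cons_self_tail]

lemma finite_walks (hS : S.Finite) (a : ℤ × ℤ) (n : ℕ) : Finite (Walks S R a n) := by
  have := hS.to_subtype
  induction n generalizing a with
  | zero =>
    refine Finite.of_injective (β := Unit) (fun _ => ()) ?_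
    rintro ⟨w, h, -⟩ ⟨w', h', -⟩ -
    refine Subtype.ext (funext fun k => ?_)
    obtain rfl : k = 0 := Subsingleton.elim (α := Fin 1) k 0
    exact h.trans h'.symm
  | succ n ih =>
    by_cases ha : a ∈ R
    · have := fun e : S => ih (a + e)
      exact Finite.of_surjective _ (walks_cons_bijective ha n).2
    · have : IsEmpty (Walks S R a (n + 1)) := ⟨fun w => ha (by simpa [w.2.1] using w.2.2.2 0)⟩
      infer_instance

lemma walkCountAll_of_notMem (ha : a ∉ R) (n : ℕ) : walkCountAll S R a n = 0 := by
  have : IsEmpty (Walks S R a n) := ⟨fun w => ha (by simpa [w.2.1] using w.2.2.2 0)⟩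
  exact Nat.card_of_isEmpty

lemma walkCountAll_zero (ha : a ∈ R) : walkCountAll S R a 0 = 1 := by
  refine Nat.card_eq_one_iff_unique.2 ⟨⟨?_⟩, ⟨⟨fun _ => a, rfl, fun k => k.elim0, fun _ => ha⟩⟩⟩
  rintro ⟨w, h, -⟩ ⟨w', h', -⟩
  refine Subtype.ext (funext fun k => ?_)
  obtain rfl : k = 0 := Subsingleton.elim (α := Fin 1) k 0
  exact h.trans h'.symm

lemma walkCountAll_succ {S : Finset (ℤ × ℤ)} (ha : a ∈ R) (n : ℕ) :
    walkCountAll S R a (n + 1) = ∑ e ∈ S, walkCountAll S R (a + e) n := by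
  have := fun e : (S : Set (ℤ × ℤ)) => finite_walks (R := R) S.finite_toSet (a + e) n
  rw [← Finset.sum_coe_sort]
  exact (Nat.card_eq_of_bijective _ (walks_cons_bijective (S := S) ha n)).symm.trans Nat.card_sigma

lemma diagSteps_eq :
    diagSteps = (({(1,1), (1,-1), (-1,1), (-1,-1)} : Finset (ℤ × ℤ)) : Set (ℤ × ℤ)) := by
  simp [diagSteps]

/-- The number of diagonal walks of length `n` from `(i, j)` in the three-quadrant cone. -/
noncomputable def coneCount (n : ℕ) (i j : ℤ) : ℤ := walkCountAll diagSteps coneC (i, j) n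

lemma coneCount_zero {i j : ℤ} (h : 0 ≤ i ∨ 0 ≤ j) : coneCount 0 i j = 1 := by
  rw [coneCount, walkCountAll_zero (show (i, j) ∈ coneC from h), Nat.cast_one]

lemma coneCount_of_neg {i j : ℤ} (hi : i < 0) (hj : j < 0) (n : ℕ) : coneCount n i j = 0 := by
  rw [coneCount, walkCountAll_of_notMem (fun h : (0 : ℤ) ≤ i ∨ (0 : ℤ) ≤ j => by omega),
    Nat.cast_zero]

lemma coneCount_succ {i j : ℤ} (h : 0 ≤ i ∨ 0 ≤ j) (n : ℕ) :
    coneCount (n + 1) i j = coneCount n (i + 1) (j + 1) + coneCount n (i + 1) (j - 1)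
      + coneCount n (i - 1) (j + 1) + coneCount n (i - 1) (j - 1) := by
  simp only [coneCount]
  rw [diagSteps_eq, walkCountAll_succ (show (i, j) ∈ coneC from h), Finset.sum_insert (by decide),
    Finset.sum_insert (by decide), Finset.sum_insert (by decide), Finset.sum_singleton]
  push_cast
  simp only [Prod.mk_add_mk, ← sub_eq_add_neg, add_assoc]

lemma coneCount_comm (n : ℕ) (i j : ℤ) : coneCount n i j = coneCount n j i := by
  induction n generalizing i j with
  | zero =>
    by_cases h : 0 ≤ i ∨ 0 ≤ j
    · rw [coneCount_zero h, coneCount_zero h.symm]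
    · rw [coneCount_of_neg, coneCount_of_neg] <;> omega
  | succ n ih =>
    by_cases h : 0 ≤ i ∨ 0 ≤ j
    · rw [coneCount_succ h, coneCount_succ h.symm, ih (i + 1), ih (i + 1), ih (i - 1), ih (i - 1)]
      ring
    · rw [coneCount_of_neg, coneCount_of_neg] <;> omega

/-- The number of simple walks of length `n` from `i` staying nonnegative. -/
def lineCount : ℕ → ℤ → ℤ
  | 0, i => if 0 ≤ i then 1 else 0
  | n + 1, i => if 0 ≤ i then lineCount n (i - 1) + lineCount n (i + 1) else 0

lemma lineCount_of_neg {i : ℤ} (hi : i < 0) (n : ℕ) : lineCount n i = 0 := by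
  cases n <;> simp [lineCount, hi]

lemma coneCount_reflection (n : ℕ) {i j : ℤ} (hi : -1 ≤ i) (hj : -1 ≤ j) :
    coneCount n i j - coneCount n (-2 - i) j - coneCount n i (-2 - j)
      + lineCount n i * lineCount n j = 0 := by
  induction n generalizing i j with
  | zero =>
    by_cases hi' : 0 ≤ i <;> by_cases hj' : 0 ≤ j
    · rw [coneCount_zero (Or.inl hi'), coneCount_zero (Or.inr hj'), coneCount_zero (Or.inl hi')]
      simp [lineCount, hi', hj']
    · obtain rfl : j = -1 := by omega
      rw [coneCount_of_neg (i := -2 - i) (by omega) (by norm_num), lineCount_of_neg (i := -1)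
        (by norm_num)]
      norm_num
    · obtain rfl : i = -1 := by omega
      rw [coneCount_of_neg (j := -2 - j) (by norm_num) (by omega), lineCount_of_neg (i := -1)
        (by norm_num)]
      norm_num
    · rw [coneCount_of_neg, coneCount_of_neg, coneCount_of_neg, lineCount_of_neg] <;> grind
  | succ n ih =>
    by_cases hi' : 0 ≤ i <;> by_cases hj' : 0 ≤ j
    · have h1 := ih (i := i + 1) (j := j + 1) (by omega) (by omega)
      have h2 := ih (i := i + 1) (j := j - 1) (by omega) (by omega)
      have h3 := ih (i := i - 1) (j := j + 1) (by omega) (by omega)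
      have h4 := ih (i := i - 1) (j := j - 1) (by omega) (by omega)
      rw [coneCount_succ (Or.inl hi'), coneCount_succ (Or.inr hj'), coneCount_succ (Or.inl hi')]
      simp only [lineCount, hi', hj', if_true]
      simp only [show ∀ k : ℤ, -2 - (k + 1) = -2 - k - 1 by intro k; ring,
        show ∀ k : ℤ, -2 - (k - 1) = -2 - k + 1 by intro k; ring] at h1 h2 h3 h4
      linear_combination h1 + h2 + h3 + h4
    · obtain rfl : j = -1 := by omega
      rw [coneCount_of_neg (i := -2 - i) (by omega) (by norm_num), lineCount_of_neg (i := -1)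
        (by norm_num)]
      norm_num
    · obtain rfl : i = -1 := by omega
      rw [coneCount_of_neg (j := -2 - j) (by norm_num) (by omega), lineCount_of_neg (i := -1)
        (by norm_num)]
      norm_num
    · obtain rfl : i = -1 := by omega
      obtain rfl : j = -1 := by omega
      rw [lineCount_of_neg (by norm_num)]
      norm_num
      exact coneCount_of_neg (by norm_num) (by norm_num) _

lemma coneCount_eq_walkOp (n a b : ℕ) :
    (coneCount n b (b - 2 * a) : ℝ) = (walkOp foldNbrs 1 ^ n) (fun _ => 1) (a, b) := by
  induction n generalizing a b with
  | zero => rw [coneCount_zero (Or.inl (by positivity))]; simp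
  | succ n ih =>
    rw [coneCount_succ (Or.inl (by positivity)), walkOp_pow_succ, walkOp_apply, one_mul]
    push_cast
    rcases a with _ | a <;> rcases b with _ | b <;>
      simp only [foldNbrs, List.map_cons, List.map_nil,
      List.sum_cons, List.sum_nil, ← ih]
    all_goals push_cast
    · norm_num
      rw [coneCount_of_neg (i := -1) (j := -1) (by norm_num) (by norm_num),
        coneCount_comm n (-1)]
      push_cast
      ring
    · rw [coneCount_comm n ((b : ℤ) + 1 - 1) _]
      ring_nf
    · norm_num
      rw [coneCount_of_neg (i := -1) (by norm_num) (by omega),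
        coneCount_of_neg (i := -1) (by norm_num) (by omega)]
      push_cast
      ring_nf
    · ring_nf

lemma lineCount_nonneg (n : ℕ) (i : ℤ) : 0 ≤ lineCount n i := by
  induction n generalizing i with
  | zero => rw [lineCount]; split_ifs <;> norm_num
  | succ n ih =>
    rw [lineCount]
    split_ifs
    · exact add_nonneg (ih _) (ih _)
    · rfl

lemma lineCount_le (n : ℕ) (i : ℤ) : lineCount n i ≤ 2 ^ n := by
  induction n generalizing i with
  | zero => rw [lineCount]; split_ifs <;> norm_num
  | succ n ih =>
    rw [lineCount]
    split_ifs
    · rw [pow_succ]; linarith [ih (i - 1), ih (i + 1)]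
    · positivity

lemma sum_lineCount_le {s ρ : ℝ} (hs : 0 ≤ s) (hs1 : s < 1) (hρ : 0 ≤ ρ) (hρ1 : ρ ≤ 1)
    (h : 2 * ρ ≤ s * (1 + ρ ^ 2)) (n i : ℕ) :
    ∑ k ∈ Finset.range n, (lineCount k (i - 1) : ℝ) * (s / 2) ^ k ≤ (1 - ρ ^ i) / (1 - s) := by
  have hs' : 0 < 1 - s := by linarith
  induction n generalizing i with
  | zero =>
    have : ρ ^ i ≤ 1 := pow_le_one₀ hρ hρ1
    rw [Finset.sum_range_zero]
    exact div_nonneg (by linarith) hs'.le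
  | succ n ih =>
    rcases i with _ | i
    · simp [lineCount_of_neg]
    · have e : ∀ k, (lineCount (k + 1) (((i + 1 : ℕ) : ℤ) - 1) : ℝ) * (s / 2) ^ (k + 1)
          = s / 2 * (lineCount k ((i : ℤ) - 1) * (s / 2) ^ k)
            + s / 2 * (lineCount k (((i + 2 : ℕ) : ℤ) - 1) * (s / 2) ^ k) := by
        intro k
        rw [lineCount, if_pos (by push_cast; omega), pow_succ]
        push_cast
        ring_nf
      rw [Finset.sum_range_succ', Finset.sum_congr rfl fun k _ => e k, Finset.sum_add_distrib,
        ← Finset.mul_sum, ← Finset.mul_sum]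
      have h1 := mul_le_mul_of_nonneg_left (ih i) (by positivity : 0 ≤ s / 2)
      have h2 := mul_le_mul_of_nonneg_left (ih (i + 2)) (by positivity : 0 ≤ s / 2)
      have h0 : (lineCount 0 (((i + 1 : ℕ) : ℤ) - 1) : ℝ) * (s / 2) ^ 0 = 1 := by
        simp [lineCount]
      rw [h0]
      refine (add_le_add_left (add_le_add h1 h2) 1).trans ?_
      have h3 := mul_le_mul_of_nonneg_left h (pow_nonneg hρ i)
      rw [← mul_div_assoc, ← mul_div_assoc, ← add_div, div_add' _ _ _ hs'.ne',
        div_le_div_iff_of_pos_right hs']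
      linear_combination h3 / 2

lemma walkOp_const_mul {α : Type*} (N : α → List α) (c t : ℝ) (n : ℕ) (φ : α → ℝ) (x : α) :
    (walkOp N (c * t) ^ n) φ x = c ^ n * (walkOp N t ^ n) φ x := by
  have : walkOp N (c * t) = c • walkOp N t := by
    ext φ x
    simp [walkOp_apply, mul_assoc]
  rw [this, smul_pow]
  rfl

lemma walkOp_pow_mono {α : Type*} {N : α → List α} {t : ℝ} (ht : 0 ≤ t) {φ ψ : α → ℝ}
    (h : ∀ x, φ x ≤ ψ x) (n : ℕ) (x : α) : (walkOp N t ^ n) φ x ≤ (walkOp N t ^ n) ψ x := by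
  induction n generalizing x with
  | zero => exact h x
  | succ n ih =>
    rw [walkOp_pow_succ, walkOp_pow_succ, walkOp_apply, walkOp_apply]
    exact mul_le_mul_of_nonneg_left (List.sum_le_sum fun y _ => ih y) ht

/-- The probability that a random diagonal walk from the origin stays in the cone up to time `n`. -/
noncomputable def coneProb (n : ℕ) : ℝ := walkCountAll diagSteps coneC (0, 0) n / 4 ^ n

lemma coneProb_nonneg (n : ℕ) : 0 ≤ coneProb n := by rw [coneProb]; positivity

lemma coneProb_eq_walkOp (n : ℕ) :
    coneProb n = (walkOp foldNbrs (1 / 4) ^ n) (fun _ => 1) (0, 0) := by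
  have h := coneCount_eq_walkOp n 0 0
  rw [← mul_one (1 / 4 : ℝ), walkOp_const_mul, ← h, coneProb, coneCount]
  push_cast
  norm_num
  rw [one_div, inv_pow]
  ring

lemma coneProb_antitone : Antitone coneProb := by
  refine antitone_nat_of_succ_le fun n => ?_
  rw [coneProb_eq_walkOp, coneProb_eq_walkOp, walkOp_pow_succ_right]
  refine walkOp_pow_mono (by norm_num) (fun x => ?_) n _
  have h : ((foldNbrs x).length : ℝ) ≤ 4 := by exact_mod_cast length_foldNbrs_le x
  simp only [walkOp_apply, List.map_const', List.sum_replicate, nsmul_eq_mul, mul_one]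
  linarith

lemma coneProb_le_one (n : ℕ) : coneProb n ≤ 1 := by
  refine (coneProb_antitone n.zero_le).trans_eq ?_
  simp [coneProb_eq_walkOp]

lemma summable_coneProb {s : ℝ} (hs : 0 ≤ s) (hs1 : s < 1) :
    Summable fun n => coneProb n * s ^ n :=
  Summable.of_nonneg_of_le (fun n => mul_nonneg (coneProb_nonneg n) (by positivity))
    (fun n => mul_le_of_le_one_left (by positivity) (coneProb_le_one n))
    (summable_geometric_of_lt_one hs hs1)

lemma exists_green_eq {s : ℝ} (hs : 3 / 4 ≤ s) (hs1 : s < 1) : ∃ E : ℝ, 0 ≤ E ∧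
    E ≤ 2 / √(1 - s) ∧ 2 / 3 * (green foldNbrs s (fun _ => (1 : ℝ)) (0, 0)
      + green foldNbrs s (fun _ => (1 : ℝ)) (1, 0)) = (∑' n, coneProb n * s ^ n) + E := by
  have hs0 : 0 ≤ s := by linarith
  have hs' : 0 < 1 - s := by linarith
  set q : ℕ → ℝ := fun n => (lineCount n 0 : ℝ) ^ 2 / 4 ^ n * s ^ n / 3 with hq
  have hK0 : ∀ n, (0 : ℝ) ≤ lineCount n 0 := fun n => by exact_mod_cast lineCount_nonneg n 0
  have hK1 : ∀ n, (lineCount n 0 : ℝ) ≤ 2 ^ n := fun n => by exact_mod_cast lineCount_le n 0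
  have hq0 : ∀ n, 0 ≤ q n := fun n => by positivity
  have hql : ∀ n, q n ≤ lineCount n 0 * (s / 2) ^ n := by
    intro n
    have h1 : q n = (lineCount n 0 / 2 ^ n * (lineCount n 0 * (s / 2) ^ n)) / 3 := by
      simp only [hq]
      rw [div_pow, show (4 : ℝ) ^ n = 2 ^ n * 2 ^ n by rw [← mul_pow]; norm_num]
      field_simp
    have h2 : (lineCount n 0 : ℝ) / 2 ^ n ≤ 1 := div_le_one_of_le₀ (hK1 n) (by positivity)
    have h3 : 0 ≤ lineCount n 0 * (s / 2) ^ n := mul_nonneg (hK0 n) (by positivity)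
    have h4 := mul_le_of_le_one_left h3 h2
    rw [h1]
    linarith
  have hr : √(1 - s) ^ 2 = 1 - s := Real.sq_sqrt hs'.le
  have hr0 : 0 < √(1 - s) := Real.sqrt_pos.2 hs'
  have hr1 : √(1 - s) ≤ 1 / 2 := by
    rw [Real.sqrt_le_left (by norm_num)]; linarith
  have hsum : ∀ n, ∑ k ∈ Finset.range n, q k ≤ 2 / √(1 - s) := by
    intro n
    have h := sum_lineCount_le (ρ := 1 - 2 * √(1 - s)) hs0 hs1 (by linarith) (by linarith)
      (by nlinarith) n 1
    simp only [Nat.cast_one, sub_self] at h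
    refine (Finset.sum_le_sum fun k _ => hql k).trans (h.trans_eq ?_)
    nth_rewrite 2 [← hr]
    field_simp
    ring
  have hqs : Summable q := summable_of_sum_range_le hq0 hsum
  have hS := summable_green (𝕜 := ℝ) length_foldNbrs_le hs0 hs1 (φ := fun _ => (1 : ℝ)) (M := 1)
    (by simp)
  refine ⟨∑' n, q n, tsum_nonneg hq0, hqs.tsum_le_of_sum_range_le hsum, ?_⟩
  rw [← (summable_coneProb hs0 hs1).tsum_add hqs]
  unfold green
  rw [← (hS _).tsum_add (hS _), ← tsum_mul_left]
  refine tsum_congr fun n => ?_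
  have h1 := coneCount_eq_walkOp n 0 0
  have h2 := coneCount_eq_walkOp n 1 0
  have h3 := coneCount_reflection n (i := 0) (j := 0) (by norm_num) (by norm_num)
  norm_num at h1 h2 h3
  rw [coneCount_comm n (-2)] at h3
  have h4 : (coneCount n 0 0 : ℝ) - coneCount n 0 (-2) - coneCount n 0 (-2)
      + lineCount n 0 * lineCount n 0 = 0 := by exact_mod_cast h3
  have h5 : coneProb n = coneCount n 0 0 / 4 ^ n := by rw [coneProb, coneCount]; push_cast; rfl
  have h6 : (((s / 4 : ℝ) : ℝ)) = s / 4 * 1 := by ring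
  change 2 / 3 * ((walkOp foldNbrs (s / 4) ^ n) (fun _ => (1 : ℝ)) (0, 0)
    + (walkOp foldNbrs (s / 4) ^ n) (fun _ => (1 : ℝ)) (1, 0)) = _
  rw [h6, walkOp_const_mul, walkOp_const_mul, ← h1, ← h2, h5, div_pow]
  simp only [hq]
  field_simp
  linear_combination (-1 : ℝ) * h4

end Counting

section GeneratingFunction

lemma mul_green_edgeFn_one {s : ℝ} (hs : 0 < s) (hs1 : s < 1) (x : ℕ × ℕ) :
    (s : ℂ) / 4 * green foldNbrs s (edgeFn (1 : ℂ)) x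
      = 1 - (1 - s) * green foldNbrs s (fun _ => (1 : ℝ)) x := by
  set u : ℕ × ℕ → ℂ := fun _ => 1 with hu
  have h1 : u - walkOp foldNbrs (((s / 4 : ℝ)) : ℂ) u
      = ((s : ℂ) / 4) • edgeFn (1 : ℂ) + (1 - s : ℂ) • u := by
    funext ⟨a, b⟩
    rcases a with _ | a <;> rcases b with _ | b <;>
    simp [foldNbrs, edgeFn, walkOp_apply, hu] <;> ring
  have hb : ∀ x, ‖u x‖ ≤ 1 := by simp [hu]
  have h2 := green_sub_walkOp (𝕜 := ℂ) length_foldNbrs_le hs.le hs1 hb x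
  have e := norm_edgeFn_le (𝕜 := ℂ) (z := 1) (by simp)
  replace h2 : green foldNbrs s (((s : ℂ) / 4) • edgeFn (1 : ℂ) + (1 - s : ℂ) • u) x = u x := by
    rw [← h1]; exact h2
  rw [green_add (M := ‖(s : ℂ) / 4‖ * 2) (M' := ‖(1 - s : ℂ)‖ * 1) length_foldNbrs_le hs.le hs1
    (fun x => by
      rw [Pi.smul_apply, norm_smul]; exact mul_le_mul_of_nonneg_left (e x) (norm_nonneg _))
    (fun x => by
      rw [Pi.smul_apply, norm_smul]; exact mul_le_mul_of_nonneg_left (hb x) (norm_nonneg _)),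
    green_smul, green_smul] at h2
  have h3 : green foldNbrs s u x = ((green foldNbrs s (fun _ => (1 : ℝ)) x : ℝ) : ℂ) := by
    rw [← green_ofReal]; simp [hu]
  rw [h3] at h2
  linear_combination h2

lemma foldLeft_one {s : ℝ} (hs : 0 < s) (hs1 : s < 1) : foldLeft s 1 =
    ((-(4 / 3 * (1 / s - 1) + (1 - s) * (2 / 3 * (green foldNbrs s (fun _ => (1 : ℝ)) (0, 0)
      + green foldNbrs s (fun _ => (1 : ℝ)) (1, 0)))) : ℝ) : ℂ) := by
  have h0 := mul_green_edgeFn_one hs hs1 (0, 0)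
  have h1 := mul_green_edgeFn_one hs hs1 (1, 0)
  have hs0 : (s : ℂ) ≠ 0 := by exact_mod_cast hs.ne'
  rw [foldLeft, edgeGF]
  push_cast
  linear_combination 2 / 3 * (h0 + h1)

lemma green_nonneg {s : ℝ} (hs : 0 ≤ s) (x : ℕ × ℕ) :
    0 ≤ green foldNbrs s (fun _ => (1 : ℝ)) x := by
  refine tsum_nonneg fun n => ?_
  have := walkOp_pow_mono (N := foldNbrs) (t := s / 4) (by positivity) (φ := 0)
    (ψ := fun _ => (1 : ℝ)) (fun _ => zero_le_one) n x
  rwa [map_zero] at this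

lemma exists_foldLeft_eq : ∃ T η : ℝ → ℝ, ∀ s, 3 / 4 ≤ s → s < 1 → 0 ≤ T s ∧ 0 < η s ∧
    (η s) ^ 3 ≤ (1 - s) ^ 2 / s ^ 2 ∧
    T s ^ 6 / (1 - s) ^ 2 = (256 / (s * (1 - η s) * (3 + η s) ^ 3)) ^ 2 * (4 / s ^ 2)
      * (1 + η s) ^ 3 * (3 - η s) ^ 3 / 729 ∧
    ∃ E, 0 ≤ E ∧ E ≤ 2 / √(1 - s) ∧
      T s = 4 / 3 * (1 / s - 1) + (1 - s) * ((∑' n, coneProb n * s ^ n) + E) := by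
  have key : ∀ s : ℝ, ∃ T η : ℝ, 3 / 4 ≤ s → s < 1 → 0 ≤ T ∧ 0 < η ∧
      η ^ 3 ≤ (1 - s) ^ 2 / s ^ 2 ∧
      T ^ 6 / (1 - s) ^ 2 = (256 / (s * (1 - η) * (3 + η) ^ 3)) ^ 2 * (4 / s ^ 2)
        * (1 + η) ^ 3 * (3 - η) ^ 3 / 729 ∧
      ∃ E, 0 ≤ E ∧ E ≤ 2 / √(1 - s) ∧
        T = 4 / 3 * (1 / s - 1) + (1 - s) * ((∑' n, coneProb n * s ^ n) + E) := by
    intro s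
    by_cases h : 3 / 4 ≤ s ∧ s < 1
    swap
    · exact ⟨0, 0, fun h1 h2 => absurd ⟨h1, h2⟩ h⟩
    obtain ⟨hs, hs1⟩ := h
    have hs0 : 0 < s := by linarith
    have hs' : 0 < 1 - s := by linarith
    obtain ⟨M, η, h0, h1, hM, hε, hF⟩ := exists_foldLeft_one hs0 hs1
    obtain ⟨E, hE0, hE1, hE⟩ := exists_green_eq hs hs1
    set A := 2 / 3 * (green foldNbrs s (fun _ => (1 : ℝ)) (0, 0)
      + green foldNbrs s (fun _ => (1 : ℝ)) (1, 0)) with hA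
    have hA0 : 0 ≤ A := by
      have := green_nonneg hs0.le (0, 0)
      have := green_nonneg hs0.le (1, 0)
      positivity
    have hηe := uniformization_bounds (four_lt_kappa hs0 hs1) h0 h1 hM hε
    have hT2 : (4 / 3 * (1 / s - 1) + (1 - s) * A) ^ 2 = M * η * (1 + η) * (3 - η) / 9 := by
      rw [foldLeft_one hs0 hs1, ← hA] at hF
      have hF' : (-(4 / 3 * (1 / s - 1) + (1 - s) * A)) ^ 2 = M * η * (1 + η) * (3 - η) / 9 := by
        exact_mod_cast hF
      rwa [neg_sq] at hF'
    refine ⟨4 / 3 * (1 / s - 1) + (1 - s) * A, η, fun _ _ => ⟨?_, h0, ?_, ?_,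
      E, hE0, hE1, by rw [← hE]⟩⟩
    · have : 1 ≤ 1 / s := by rw [le_div_iff₀ hs0]; linarith
      have := mul_nonneg hs'.le hA0
      linarith
    · refine hηe.trans_eq ?_
      field_simp
      ring
    · have hη1 : 1 - η ≠ 0 := by linarith
      have hM' : M = 256 / (s * (1 - η) * (3 + η) ^ 3) := by
        rw [eq_div_iff (by positivity)]
        have : s * (64 * (4 / s)) = 256 := by field_simp; norm_num
        rw [← this, hM]
        ring
      have hε' : M * η ^ 3 = 4 * (1 - s) ^ 2 / s ^ 2 := by
        rw [← hε]; field_simp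
      rw [← hM', div_eq_iff (by positivity)]
      calc _ = ((4 / 3 * (1 / s - 1) + (1 - s) * A) ^ 2) ^ 3 := by ring
        _ = M ^ 2 * (M * η ^ 3) * (1 + η) ^ 3 * (3 - η) ^ 3 / 729 := by rw [hT2]; ring
        _ = _ := by rw [hε']; ring
  choose T η h using key
  exact ⟨T, η, h⟩

lemma tendsto_coneProb_gf : Tendsto (fun s : ℝ => (1 - s) ^ (2 / 3 : ℝ) * ∑' n, coneProb n * s ^ n)
    (𝓝[<] 1) (𝓝 (8 * √3 / 9)) := by
  obtain ⟨T, η, h⟩ := exists_foldLeft_eq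
  have hev : ∀ᶠ s : ℝ in 𝓝[<] 1, 3 / 4 ≤ s ∧ s < 1 := by
    filter_upwards [Ioo_mem_nhdsLT (show (3 / 4 : ℝ) < 1 by norm_num)] with s hs
    exact ⟨hs.1.le, hs.2⟩
  have hid : Tendsto (fun s : ℝ => s) (𝓝[<] 1) (𝓝 1) := tendsto_id.mono_left nhdsWithin_le_nhds
  have hη3 : Tendsto (fun s => η s ^ 3) (𝓝[<] 1) (𝓝 0) := by
    refine tendsto_of_tendsto_of_tendsto_of_le_of_le' tendsto_const_nhds
      (h := fun s : ℝ => (1 - s) ^ 2 / s ^ 2) ?_ ?_ ?_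
    · have : Tendsto (fun s : ℝ => (1 - s) ^ 2 / s ^ 2) (𝓝[<] 1) (𝓝 ((1 - 1) ^ 2 / 1 ^ 2)) :=
        ((tendsto_const_nhds.sub hid).pow 2).div (hid.pow 2) (by norm_num)
      simpa using this
    · filter_upwards [hev] with s hs
      exact pow_nonneg (h s hs.1 hs.2).2.1.le 3
    · filter_upwards [hev] with s hs
      exact (h s hs.1 hs.2).2.2.1
  have hη : Tendsto η (𝓝[<] 1) (𝓝 0) := by
    have := hη3.rpow_const (p := (1 / 3 : ℝ)) (Or.inr (by norm_num))
    rw [Real.zero_rpow (by norm_num)] at this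
    refine this.congr' ?_
    filter_upwards [hev] with s hs
    rw [← Real.rpow_natCast, ← Real.rpow_mul (h s hs.1 hs.2).2.1.le]
    norm_num
  have hL : Tendsto (fun s => T s ^ 6 / (1 - s) ^ 2) (𝓝[<] 1) (𝓝 ((8 * √3 / 9) ^ 6)) := by
    have hc : ContinuousAt (fun p : ℝ × ℝ => (256 / (p.1 * (1 - p.2) * (3 + p.2) ^ 3)) ^ 2
        * (4 / p.1 ^ 2) * (1 + p.2) ^ 3 * (3 - p.2) ^ 3 / 729) (1, 0) := by
      have h1 : ((1 : ℝ), (0 : ℝ)).1 * (1 - ((1 : ℝ), (0 : ℝ)).2) * (3 + ((1 : ℝ), (0 : ℝ)).2) ^ 3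
        ≠ 0 := by norm_num
      have h2 : ((1 : ℝ), (0 : ℝ)).1 ^ 2 ≠ 0 := by norm_num
      fun_prop (disch := assumption)
    have := hc.tendsto.comp (hid.prodMk_nhds hη)
    have h3 : √(3 : ℝ) ^ 6 = 27 := by
      rw [show (6 : ℕ) = 2 * 3 by norm_num, pow_mul, Real.sq_sqrt (by norm_num)]; norm_num
    rw [div_pow, mul_pow, h3]
    refine (this.congr' ?_).trans_eq ?_
    · filter_upwards [hev] with s hs
      exact (h s hs.1 hs.2).2.2.2.1.symm
    · norm_num
  have hL' : Tendsto (fun s => T s / (1 - s) ^ (1 / 3 : ℝ)) (𝓝[<] 1) (𝓝 (8 * √3 / 9)) := by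
    have := hL.rpow_const (p := (1 / 6 : ℝ)) (Or.inr (by norm_num))
    rw [← Real.rpow_natCast, ← Real.rpow_mul (by positivity)] at this
    norm_num at this
    refine this.congr' ?_
    filter_upwards [hev] with s hs
    have hs' : 0 < 1 - s := by linarith [hs.2]
    have h0 := (h s hs.1 hs.2).1
    rw [Real.div_rpow (by positivity) (by positivity), ← Real.rpow_natCast, ← Real.rpow_natCast,
      ← Real.rpow_mul h0, ← Real.rpow_mul hs'.le]
    norm_num
  have hrem : Tendsto (fun s : ℝ => 4 / 3 / s * (1 - s) ^ (2 / 3 : ℝ)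
      + 2 * (1 - s) ^ (1 / 6 : ℝ)) (𝓝[<] 1) (𝓝 0) := by
    have h1 := (tendsto_const_nhds (x := (1 : ℝ))).sub hid
    have h2 := h1.rpow_const (p := (2 / 3 : ℝ)) (Or.inr (by norm_num))
    have h3 := h1.rpow_const (p := (1 / 6 : ℝ)) (Or.inr (by norm_num))
    have h4 := (((tendsto_const_nhds (x := (4 / 3 : ℝ))).div hid one_ne_zero).mul h2).add
      (h3.const_mul 2)
    simpa [Real.zero_rpow] using h4
  have hlow := hL'.sub hrem
  rw [sub_zero] at hlow
  refine tendsto_of_tendsto_of_tendsto_of_le_of_le' hlow hL' ?_ ?_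
  all_goals
    filter_upwards [hev] with s hs
    obtain ⟨-, -, -, -, E, hE0, hE1, hE⟩ := h s hs.1 hs.2
    have hs0 : 0 < s := by linarith [hs.1]
    have hs' : 0 < 1 - s := by linarith [hs.2]
    have e1 : (1 - s) = (1 - s) ^ (1 / 3 : ℝ) * (1 - s) ^ (2 / 3 : ℝ) := by
      rw [← Real.rpow_add hs']; norm_num
    have e2 : (1 - s) ^ (2 / 3 : ℝ) = (1 - s) ^ (1 / 6 : ℝ) * √(1 - s) := by
      rw [Real.sqrt_eq_rpow, ← Real.rpow_add hs']; norm_num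
    have e3 : T s / (1 - s) ^ (1 / 3 : ℝ) = 4 / 3 / s * (1 - s) ^ (2 / 3 : ℝ)
        + (1 - s) ^ (2 / 3 : ℝ) * (∑' n, coneProb n * s ^ n) + (1 - s) ^ (2 / 3 : ℝ) * E := by
      have : 1 / s - 1 = (1 - s) / s := by field_simp
      rw [hE, this, div_eq_iff (by positivity)]
      linear_combination (4 / 3 / s + (∑' n, coneProb n * s ^ n) + E) * e1
    have hc : 0 ≤ 4 / 3 / s * (1 - s) ^ (2 / 3 : ℝ) := by positivity
    have hE2 : 0 ≤ (1 - s) ^ (2 / 3 : ℝ) * E := by positivity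
    have hr0 : 0 < √(1 - s) := Real.sqrt_pos.2 hs'
    have hE3 : (1 - s) ^ (2 / 3 : ℝ) * E ≤ 2 * (1 - s) ^ (1 / 6 : ℝ) := by
      refine (mul_le_mul_of_nonneg_left hE1 (by positivity)).trans_eq ?_
      rw [e2]
      field_simp
    rw [e3]
    linarith

end GeneratingFunction

section Tauberian

open MeasureTheory

/-- The normalised Gamma integral `Γ(α)⁻¹ ∫₀^∞ e⁻ˣ x^(α-1) g(e⁻ˣ) dx`. -/
noncomputable def gammaMean (α : ℝ) (g : ℝ → ℝ) : ℝ :=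
  (∫ x in Ioi (0 : ℝ), Real.exp (-x) * x ^ (α - 1) * g (Real.exp (-x))) / Real.Gamma α

lemma exists_abs_le_of_continuous {g : ℝ → ℝ} (hg : Continuous g) :
    ∃ B, ∀ y ∈ Icc (0 : ℝ) 1, |g y| ≤ B :=
  isCompact_Icc.exists_bound_of_continuousOn hg.continuousOn

lemma exp_neg_mem_Icc {x : ℝ} (hx : 0 ≤ x) : Real.exp (-x) ∈ Icc (0 : ℝ) 1 :=
  ⟨(Real.exp_pos _).le, Real.exp_le_one_iff.2 (by linarith)⟩

lemma integrableOn_gammaMean {α : ℝ} (hα : 0 < α) {g : ℝ → ℝ} (hg : Continuous g) :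
    IntegrableOn (fun x => Real.exp (-x) * x ^ (α - 1) * g (Real.exp (-x))) (Ioi 0) := by
  obtain ⟨B, hB⟩ := exists_abs_le_of_continuous hg
  refine Integrable.mul_bdd (c := B) (Real.GammaIntegral_convergent hα)
    (hg.comp (Real.continuous_exp.comp continuous_neg)).aestronglyMeasurable ?_
  filter_upwards [ae_restrict_mem measurableSet_Ioi] with x hx
  exact hB _ (exp_neg_mem_Icc (le_of_lt hx))

lemma gammaMean_add {α : ℝ} (hα : 0 < α) {g h : ℝ → ℝ} (hg : Continuous g) (hh : Continuous h) :
    gammaMean α (fun y => g y + h y) = gammaMean α g + gammaMean α h := by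
  rw [gammaMean, gammaMean, gammaMean, ← add_div,
    ← integral_add (integrableOn_gammaMean hα hg) (integrableOn_gammaMean hα hh)]
  simp only [mul_add]

lemma gammaMean_const_mul (α c : ℝ) (g : ℝ → ℝ) :
    gammaMean α (fun y => c * g y) = c * gammaMean α g := by
  rw [gammaMean, gammaMean, ← mul_div_assoc, ← integral_const_mul]
  congr 2
  ext x
  ring

lemma gammaMean_pow {α : ℝ} (hα : 0 < α) (k : ℕ) :
    gammaMean α (fun y => y ^ k) = (1 / ((k : ℝ) + 1)) ^ α := by
  have h := Real.integral_rpow_mul_exp_neg_mul_Ioi hα (r := (k : ℝ) + 1) (by positivity)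
  rw [gammaMean, div_eq_iff (Real.Gamma_pos_of_pos hα).ne', ← h]
  congr 1
  ext x
  rw [← Real.exp_nat_mul, show -((k + 1 : ℝ) * x) = -x + k * -x by ring, Real.exp_add]
  ring

lemma gammaMean_mono {α : ℝ} (hα : 0 < α) {g h : ℝ → ℝ} (hg : Continuous g) (hh : Continuous h)
    (hgh : ∀ y ∈ Icc (0 : ℝ) 1, g y ≤ h y) : gammaMean α g ≤ gammaMean α h := by
  refine div_le_div_of_nonneg_right ?_ (Real.Gamma_pos_of_pos hα).le
  refine setIntegral_mono_on (integrableOn_gammaMean hα hg) (integrableOn_gammaMean hα hh)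
    measurableSet_Ioi fun x hx => ?_
  have hx0 : (0 : ℝ) < x := hx
  exact mul_le_mul_of_nonneg_left (hgh _ (exp_neg_mem_Icc hx0.le)) (by positivity)

lemma abs_gammaMean_sub_le {α : ℝ} (hα : 0 < α) {g h : ℝ → ℝ} (hg : Continuous g)
    (hh : Continuous h) {ε : ℝ} (hε : ∀ y ∈ Icc (0 : ℝ) 1, |g y - h y| ≤ ε) :
    |gammaMean α g - gammaMean α h| ≤ ε := by
  have hc : gammaMean α (fun _ => ε) = ε := by
    have h0 := gammaMean_pow hα 0
    have := gammaMean_const_mul α ε (fun y => y ^ 0)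
    rw [h0] at this
    simpa using this
  have key : ∀ {g h : ℝ → ℝ}, Continuous g → Continuous h →
      (∀ y ∈ Icc (0 : ℝ) 1, |g y - h y| ≤ ε) → gammaMean α g ≤ gammaMean α h + ε := by
    intro g h hg hh hε
    have h1 : gammaMean α g ≤ gammaMean α (fun y => h y + ε) :=
      gammaMean_mono hα hg (hh.add continuous_const)
        (fun y hy => by linarith [(abs_le.1 (hε y hy)).2])
    rwa [gammaMean_add hα hh continuous_const, hc] at h1
  rw [abs_le]
  have h1 := key hg hh hε
  have h2 := key hh hg (fun y hy => by rw [abs_sub_comm]; exact hε y hy)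
  constructor <;> linarith

variable {p : ℕ → ℝ}

lemma summable_mul_pow_mul (hp0 : ∀ n, 0 ≤ p n) (hp1 : ∀ n, p n ≤ 1) {s : ℝ} (hs : 0 ≤ s)
    (hs1 : s < 1) {g : ℝ → ℝ} (hg : Continuous g) :
    Summable fun n => p n * s ^ n * g (s ^ n) := by
  obtain ⟨B, hB⟩ := exists_abs_le_of_continuous hg
  refine Summable.of_norm_bounded (g := fun n => s ^ n * B)
    ((summable_geometric_of_lt_one hs hs1).mul_right B) fun n => ?_
  have h1 := hB (s ^ n) ⟨by positivity, pow_le_one₀ hs hs1.le⟩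
  rw [Real.norm_eq_abs, abs_mul, abs_of_nonneg (mul_nonneg (hp0 n) (by positivity))]
  have : p n * s ^ n ≤ s ^ n := mul_le_of_le_one_left (by positivity) (hp1 n)
  exact mul_le_mul this h1 (abs_nonneg _) (by positivity)

lemma tendsto_one_sub_div_one_sub_pow (k : ℕ) :
    Tendsto (fun s : ℝ => (1 - s) / (1 - s ^ (k + 1))) (𝓝[<] 1) (𝓝 (1 / ((k : ℝ) + 1))) := by
  have h : Tendsto (fun s : ℝ => ∑ i ∈ Finset.range (k + 1), s ^ i) (𝓝[<] 1)
      (𝓝 (∑ i ∈ Finset.range (k + 1), (1 : ℝ) ^ i)) :=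
    (Continuous.tendsto (by fun_prop) 1).mono_left nhdsWithin_le_nhds
  simp only [one_pow, Finset.sum_const, Finset.card_range, nsmul_eq_mul, mul_one] at h
  push_cast at h
  refine ((tendsto_const_nhds (x := (1 : ℝ))).div h (by positivity)).congr' ?_
  filter_upwards [Ioo_mem_nhdsLT (show (0 : ℝ) < 1 by norm_num)] with s hs
  have h1 : (1 : ℝ) - s ≠ 0 := by linarith [hs.2]
  have h2 : 1 - s ^ (k + 1) = (1 - s) * ∑ i ∈ Finset.range (k + 1), s ^ i := by
    linarith [geom_sum_mul s (k + 1)]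
  simp only [Pi.div_apply]
  rw [h2, div_mul_eq_div_div, div_self h1]

lemma tendsto_pow_nhdsLT_one (k : ℕ) :
    Tendsto (fun s : ℝ => s ^ (k + 1)) (𝓝[<] 1) (𝓝[<] 1) := by
  refine tendsto_nhdsWithin_iff.2 ⟨?_, ?_⟩
  · have : Tendsto (fun s : ℝ => s ^ (k + 1)) (𝓝 1) (𝓝 (1 ^ (k + 1))) :=
      (continuous_pow (k + 1)).tendsto 1
    rw [one_pow] at this
    exact this.mono_left nhdsWithin_le_nhds
  · filter_upwards [Ioo_mem_nhdsLT (show (0 : ℝ) < 1 by norm_num)] with s hs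
    exact pow_lt_one₀ hs.1.le hs.2 k.succ_ne_zero

variable {α K : ℝ}

lemma tendsto_karamata_pow (hα : 0 < α)
    (hK : Tendsto (fun s : ℝ => (1 - s) ^ α * ∑' n, p n * s ^ n) (𝓝[<] 1) (𝓝 K)) (k : ℕ) :
    Tendsto (fun s : ℝ => (1 - s) ^ α * ∑' n, p n * s ^ n * (s ^ n) ^ k) (𝓝[<] 1)
      (𝓝 (K * gammaMean α (fun y => y ^ k))) := by
  rw [gammaMean_pow hα]
  refine ((hK.comp (tendsto_pow_nhdsLT_one k)).mul
    ((tendsto_one_sub_div_one_sub_pow k).rpow_const (Or.inr hα.le))).congr' ?_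
  filter_upwards [Ioo_mem_nhdsLT (show (0 : ℝ) < 1 by norm_num)] with s hs
  have h1 : 0 < 1 - s := by linarith [hs.2]
  have h2 : 0 < 1 - s ^ (k + 1) := by
    linarith [pow_lt_one₀ hs.1.le hs.2 (n := k + 1) (by omega)]
  have h3 : ∀ n, p n * (s ^ (k + 1)) ^ n = p n * s ^ n * (s ^ n) ^ k := fun n => by ring
  simp only [Function.comp_apply, h3]
  rw [Real.div_rpow h1.le h2.le]
  field_simp

lemma tendsto_karamata_polynomial (hα : 0 < α) (hp0 : ∀ n, 0 ≤ p n) (hp1 : ∀ n, p n ≤ 1)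
    (hK : Tendsto (fun s : ℝ => (1 - s) ^ α * ∑' n, p n * s ^ n) (𝓝[<] 1) (𝓝 K))
    (P : Polynomial ℝ) :
    Tendsto (fun s : ℝ => (1 - s) ^ α * ∑' n, p n * s ^ n * P.eval (s ^ n)) (𝓝[<] 1)
      (𝓝 (K * gammaMean α (fun y => P.eval y))) := by
  induction P using Polynomial.induction_on' with
  | add P Q hP hQ =>
    simp only [Polynomial.eval_add]
    rw [gammaMean_add hα P.continuous Q.continuous, mul_add]
    refine (hP.add hQ).congr' ?_
    filter_upwards [Ioo_mem_nhdsLT (show (0 : ℝ) < 1 by norm_num)] with s hs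
    rw [← mul_add, ← (summable_mul_pow_mul hp0 hp1 hs.1.le hs.2 P.continuous).tsum_add
      (summable_mul_pow_mul hp0 hp1 hs.1.le hs.2 Q.continuous)]
    simp only [mul_add]
  | monomial k c =>
    simp only [Polynomial.eval_monomial]
    rw [gammaMean_const_mul, mul_left_comm]
    refine ((tendsto_karamata_pow hα hK k).const_mul c).congr fun s => ?_
    rw [mul_left_comm, ← tsum_mul_left]
    congr 2
    ext n
    ring

lemma tendsto_karamata (hα : 0 < α) (hp0 : ∀ n, 0 ≤ p n) (hp1 : ∀ n, p n ≤ 1) (hK0 : 0 ≤ K)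
    (hK : Tendsto (fun s : ℝ => (1 - s) ^ α * ∑' n, p n * s ^ n) (𝓝[<] 1) (𝓝 K))
    {g : ℝ → ℝ} (hg : Continuous g) :
    Tendsto (fun s : ℝ => (1 - s) ^ α * ∑' n, p n * s ^ n * g (s ^ n)) (𝓝[<] 1)
      (𝓝 (K * gammaMean α g)) := by
  rw [Metric.tendsto_nhds]
  intro ε hε
  set δ := ε / (2 * K + 2) with hδ
  have hδ0 : 0 < δ := by positivity
  obtain ⟨P, hP⟩ := exists_polynomial_near_of_continuousOn 0 1 g hg.continuousOn δ hδ0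
  have h1 := Metric.tendsto_nhds.1 (tendsto_karamata_polynomial hα hp0 hp1 hK P) δ hδ0
  have h2 := hK.eventually_lt_const (show K < K + 1 by linarith)
  filter_upwards [h1, h2, Ioo_mem_nhdsLT (show (0 : ℝ) < 1 by norm_num)] with s h1 h2 hs
  rw [Real.dist_eq] at h1 ⊢
  have hm := abs_gammaMean_sub_le hα P.continuous hg (fun y hy => (hP y hy).le)
  have hs' : 0 < 1 - s := by linarith [hs.2]
  have hsum := summable_mul_pow_mul hp0 hp1 hs.1.le hs.2 (g := fun _ => 1) continuous_const
  simp only [mul_one] at hsum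
  have hd : |(1 - s) ^ α * ∑' n, p n * s ^ n * g (s ^ n)
      - (1 - s) ^ α * ∑' n, p n * s ^ n * P.eval (s ^ n)| ≤ δ * (K + 1) := by
    rw [← mul_sub, ← (summable_mul_pow_mul hp0 hp1 hs.1.le hs.2 hg).tsum_sub
      (summable_mul_pow_mul hp0 hp1 hs.1.le hs.2 P.continuous), abs_mul,
      abs_of_pos (Real.rpow_pos_of_pos hs' α)]
    have h3 : |∑' n, (p n * s ^ n * g (s ^ n) - p n * s ^ n * P.eval (s ^ n))|
        ≤ ∑' n, p n * s ^ n * δ := by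
      rw [← Real.norm_eq_abs]
      refine tsum_of_norm_bounded (hsum.mul_right δ).hasSum fun n => ?_
      have h0 : 0 ≤ p n * s ^ n := mul_nonneg (hp0 n) (pow_nonneg hs.1.le n)
      rw [← mul_sub, Real.norm_eq_abs, abs_mul, abs_of_nonneg h0, abs_sub_comm]
      exact mul_le_mul_of_nonneg_left
        (hP _ ⟨pow_nonneg hs.1.le n, pow_le_one₀ hs.1.le hs.2.le⟩).le h0
    rw [tsum_mul_right] at h3
    calc _ ≤ (1 - s) ^ α * ((∑' n, p n * s ^ n) * δ) :=
          mul_le_mul_of_nonneg_left h3 (by positivity)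
      _ = δ * ((1 - s) ^ α * ∑' n, p n * s ^ n) := by ring
      _ ≤ _ := mul_le_mul_of_nonneg_left h2.le hδ0.le
  have hmK : |K * gammaMean α (fun y => P.eval y) - K * gammaMean α g| ≤ K * δ := by
    rw [← mul_sub, abs_mul, abs_of_nonneg hK0]
    exact mul_le_mul_of_nonneg_left hm hK0
  have hε' : ε = δ * (K + 1) + δ + K * δ + 0 := by
    rw [hδ]; field_simp; ring
  rw [abs_le] at hd hmK
  rw [abs_lt] at h1 ⊢
  constructor <;> linarith [h1.1, h1.2, hd.1, hd.2, hmK.1, hmK.2]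

/-- A continuous bump supported on `[e⁻ᵇ, e⁻ᵃ]`. -/
noncomputable def expTent (a b : ℝ) (y : ℝ) : ℝ :=
  max 0 ((y - Real.exp (-b)) * (Real.exp (-a) - y))

lemma continuous_expTent (a b : ℝ) : Continuous (expTent a b) := by
  unfold expTent
  fun_prop

lemma expTent_nonneg (a b y : ℝ) : 0 ≤ expTent a b y := le_max_left _ _

lemma mem_Ioo_of_expTent_ne_zero {a b x : ℝ} (hab : a < b)
    (h : expTent a b (Real.exp (-x)) ≠ 0) : x ∈ Ioo a b := by
  have h1 : 0 < (Real.exp (-x) - Real.exp (-b)) * (Real.exp (-a) - Real.exp (-x)) := by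
    by_contra! h'
    exact h (max_eq_left h')
  have h2 : Real.exp (-b) < Real.exp (-a) := Real.exp_lt_exp.2 (by linarith)
  rcases mul_pos_iff.1 h1 with h3 | h3
  · have h4 := Real.exp_lt_exp.1 (sub_pos.1 h3.1)
    have h5 := Real.exp_lt_exp.1 (sub_pos.1 h3.2)
    exact ⟨by linarith, by linarith⟩
  · linarith [h3.1, h3.2]

lemma expTent_pos {a b x : ℝ} (hx : x ∈ Ioo a b) : 0 < expTent a b (Real.exp (-x)) := by
  have h1 : Real.exp (-b) < Real.exp (-x) := Real.exp_lt_exp.2 (by linarith [hx.2])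
  have h2 : Real.exp (-x) < Real.exp (-a) := Real.exp_lt_exp.2 (by linarith [hx.1])
  exact lt_max_of_lt_right (mul_pos (by linarith) (by linarith))

lemma gammaMean_expTent_pos (hα : 0 < α) {a b : ℝ} (ha : 0 < a) (hab : a < b) :
    0 < gammaMean α (expTent a b) := by
  refine div_pos ?_ (Real.Gamma_pos_of_pos hα)
  rw [setIntegral_pos_iff_support_of_nonneg_ae _
    (integrableOn_gammaMean hα (continuous_expTent a b))]
  · refine lt_of_lt_of_le ?_ (measure_mono (s := Ioo a b) fun x hx => ?_)
    · simpa using hab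
    · have hx0 : 0 < x := ha.trans hx.1
      have := expTent_pos hx
      exact ⟨(show 0 < Real.exp (-x) * x ^ (α - 1) * expTent a b (Real.exp (-x)) by
        positivity).ne', hx0⟩
  · filter_upwards [ae_restrict_mem measurableSet_Ioi] with x hx
    have hx0 : (0 : ℝ) < x := hx
    exact mul_nonneg (by positivity) (expTent_nonneg a b _)

lemma gammaMean_one (g : ℝ → ℝ) :
    gammaMean 1 g = ∫ x in Ioi (0 : ℝ), Real.exp (-x) * x ^ ((1 : ℝ) - 1) * g (Real.exp (-x)) := by
  rw [gammaMean, Real.Gamma_one, div_one]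

lemma gammaMean_expTent_bounds (hα : 0 < α) (hα1 : α ≤ 1) {a b : ℝ} (ha : 0 < a) (hab : a < b) :
    b ^ (α - 1) / Real.Gamma α * gammaMean 1 (expTent a b) ≤ gammaMean α (expTent a b) ∧
    gammaMean α (expTent a b) ≤ a ^ (α - 1) / Real.Gamma α * gammaMean 1 (expTent a b) := by
  have hg := continuous_expTent a b
  have hi := integrableOn_gammaMean one_pos hg
  have hΓ := Real.Gamma_pos_of_pos hα
  rw [gammaMean_one, div_mul_eq_mul_div, div_mul_eq_mul_div, gammaMean, ← integral_const_mul,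
    ← integral_const_mul]
  constructor <;> refine div_le_div_of_nonneg_right ?_ hΓ.le
  · refine setIntegral_mono_on (hi.const_mul _) (integrableOn_gammaMean hα hg) measurableSet_Ioi
      fun x hx => ?_
    have hx0 : (0 : ℝ) < x := hx
    by_cases h : expTent a b (Real.exp (-x)) = 0
    · simp [h]
    have hxm := mem_Ioo_of_expTent_ne_zero hab h
    have h1 : b ^ (α - 1) ≤ x ^ (α - 1) :=
      Real.rpow_le_rpow_of_nonpos hx0 hxm.2.le (by linarith)
    rw [sub_self, Real.rpow_zero, mul_one]
    calc _ = b ^ (α - 1) * (Real.exp (-x) * expTent a b (Real.exp (-x))) := rfl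
      _ ≤ x ^ (α - 1) * (Real.exp (-x) * expTent a b (Real.exp (-x))) :=
        mul_le_mul_of_nonneg_right h1 (mul_nonneg (Real.exp_pos _).le (expTent_nonneg _ _ _))
      _ = _ := by ring
  · refine setIntegral_mono_on (integrableOn_gammaMean hα hg) (hi.const_mul _) measurableSet_Ioi
      fun x hx => ?_
    by_cases h : expTent a b (Real.exp (-x)) = 0
    · simp [h]
    have hxm := mem_Ioo_of_expTent_ne_zero hab h
    have h1 : x ^ (α - 1) ≤ a ^ (α - 1) :=
      Real.rpow_le_rpow_of_nonpos ha hxm.1.le (by linarith)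
    rw [sub_self, Real.rpow_zero, mul_one]
    calc _ = x ^ (α - 1) * (Real.exp (-x) * expTent a b (Real.exp (-x))) := by ring
      _ ≤ a ^ (α - 1) * (Real.exp (-x) * expTent a b (Real.exp (-x))) :=
        mul_le_mul_of_nonneg_right h1 (mul_nonneg (Real.exp_pos _).le (expTent_nonneg _ _ _))
      _ = _ := rfl

lemma exp_neg_one_div_lt_one {N : ℕ} (hN : 0 < N) : Real.exp (-(1 / (N : ℝ))) < 1 :=
  Real.exp_lt_one_iff.2 (neg_neg_of_pos (by positivity))

lemma tendsto_exp_neg_one_div :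
    Tendsto (fun N : ℕ => Real.exp (-(1 / (N : ℝ)))) atTop (𝓝[<] 1) := by
  refine tendsto_nhdsWithin_iff.2 ⟨?_, ?_⟩
  · have := (Real.continuous_exp.tendsto (-0)).comp
      (tendsto_one_div_atTop_nhds_zero_nat (𝕜 := ℝ)).neg
    rwa [neg_zero, Real.exp_zero] at this
  · filter_upwards [eventually_gt_atTop 0] with N hN
    exact exp_neg_one_div_lt_one hN

lemma exp_neg_one_div_pow (N n : ℕ) :
    Real.exp (-(1 / (N : ℝ))) ^ n = Real.exp (-((n : ℝ) / N)) := by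
  rw [← Real.exp_nat_mul]
  congr 1
  ring

lemma tendsto_karamata_ratio (hα : 0 < α) (hp0 : ∀ n, 0 ≤ p n) (hp1 : ∀ n, p n ≤ 1) (hK0 : 0 ≤ K)
    (hK : Tendsto (fun s : ℝ => (1 - s) ^ α * ∑' n, p n * s ^ n) (𝓝[<] 1) (𝓝 K))
    {g : ℝ → ℝ} (hg : Continuous g) (hg1 : 0 < gammaMean 1 g) :
    Tendsto (fun s : ℝ => (1 - s) ^ (α - 1) * (∑' n, p n * s ^ n * g (s ^ n))
      / ∑' n, s ^ n * g (s ^ n)) (𝓝[<] 1) (𝓝 (K * gammaMean α g / gammaMean 1 g)) ∧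
    ∀ᶠ s : ℝ in 𝓝[<] 1, 0 < ∑' n, s ^ n * g (s ^ n) := by
  have h1 : Tendsto (fun s : ℝ => (1 - s) ^ (1 : ℝ) * ∑' n, (1 : ℝ) * s ^ n) (𝓝[<] 1) (𝓝 1) := by
    refine tendsto_const_nhds.congr' ?_
    filter_upwards [Ioo_mem_nhdsLT (show (0 : ℝ) < 1 by norm_num)] with s hs
    have : 1 - s ≠ 0 := by linarith [hs.2]
    simp only [one_mul, Real.rpow_one]
    rw [tsum_geometric_of_lt_one hs.1.le hs.2, mul_inv_cancel₀ this]
  have h2 := tendsto_karamata one_pos (fun _ => zero_le_one) (fun _ => le_rfl) zero_le_one h1 hg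
  simp only [one_mul, Real.rpow_one] at h2
  constructor
  · refine ((tendsto_karamata hα hp0 hp1 hK0 hK hg).div h2 hg1.ne').congr' ?_
    filter_upwards [Ioo_mem_nhdsLT (show (0 : ℝ) < 1 by norm_num)] with s hs
    have hs' : 0 < 1 - s := by linarith [hs.2]
    simp only [Pi.div_apply]
    rw [Real.rpow_sub_one hs'.ne', div_mul_eq_mul_div, div_div]
  · filter_upwards [h2.eventually_const_lt hg1,
      Ioo_mem_nhdsLT (show (0 : ℝ) < 1 by norm_num)] with s h3 hs
    exact (mul_pos_iff_of_pos_left (by linarith [hs.2])).1 h3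

lemma tendsto_of_antitone (hα : 0 < α) (hα1 : α ≤ 1) (hp0 : ∀ n, 0 ≤ p n) (hp1 : ∀ n, p n ≤ 1)
    (hp : Antitone p) (hK0 : 0 ≤ K)
    (hK : Tendsto (fun s : ℝ => (1 - s) ^ α * ∑' n, p n * s ^ n) (𝓝[<] 1) (𝓝 K)) :
    Tendsto (fun N : ℕ => (1 - Real.exp (-(1 / (N : ℝ)))) ^ (α - 1) * p N) atTop
      (𝓝 (K / Real.Gamma α)) := by
  have hΓ := Real.Gamma_pos_of_pos hα
  have hcont : Tendsto (fun c : ℝ => K * (c ^ (α - 1) / Real.Gamma α)) (𝓝 1)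
      (𝓝 (K / Real.Gamma α)) := by
    have := (((continuousAt_id (x := (1 : ℝ))).rpow_const (p := α - 1)
      (Or.inl one_ne_zero)).div_const (Real.Gamma α)).const_mul K |>.tendsto
    simpa [div_eq_mul_inv] using this
  have hsum : ∀ {N : ℕ}, 0 < N → ∀ a b : ℝ,
      Summable (fun n => Real.exp (-(1 / (N : ℝ))) ^ n
        * expTent a b (Real.exp (-(1 / (N : ℝ))) ^ n)) ∧
      Summable (fun n => p n * Real.exp (-(1 / (N : ℝ))) ^ n
        * expTent a b (Real.exp (-(1 / (N : ℝ))) ^ n)) := by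
    intro N hN a b
    have h1 : Real.exp (-(1 / (N : ℝ))) < 1 :=
      exp_neg_one_div_lt_one hN
    have h2 := summable_mul_pow_mul (p := fun _ => 1) (fun _ => zero_le_one) (fun _ => le_rfl)
      (Real.exp_pos _).le h1 (continuous_expTent a b)
    simp only [one_mul] at h2
    exact ⟨h2, summable_mul_pow_mul hp0 hp1 (Real.exp_pos _).le h1 (continuous_expTent a b)⟩
  have hnn : ∀ (a b : ℝ) (N n : ℕ), 0 ≤ Real.exp (-(1 / (N : ℝ))) ^ n
      * expTent a b (Real.exp (-(1 / (N : ℝ))) ^ n) := fun a b N n =>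
    mul_nonneg (pow_nonneg (Real.exp_pos _).le n) (expTent_nonneg _ _ _)
  have hone : ∀ {N : ℕ}, 0 < N → 0 < 1 - Real.exp (-(1 / (N : ℝ))) := by
    intro N hN
    linarith [exp_neg_one_div_lt_one hN]
  refine tendsto_order.2 ⟨fun c hc => ?_, fun c hc => ?_⟩
  · obtain ⟨b, hbc, hb⟩ := (((hcont.mono_left nhdsWithin_le_nhds).eventually_const_lt hc).and
      (self_mem_nhdsWithin (s := Ioi (1 : ℝ)))).exists
    have hb1 : (1 : ℝ) < b := hb
    have hpos := gammaMean_expTent_pos one_pos one_pos hb1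
    obtain ⟨hlim, hV⟩ := tendsto_karamata_ratio hα hp0 hp1 hK0 hK (continuous_expTent 1 b) hpos
    have hc' : c < K * gammaMean α (expTent 1 b) / gammaMean 1 (expTent 1 b) := by
      refine hbc.trans_le ?_
      rw [mul_div_assoc]
      refine mul_le_mul_of_nonneg_left ?_ hK0
      rw [le_div_iff₀ hpos]
      exact (gammaMean_expTent_bounds hα hα1 one_pos hb1).1
    filter_upwards [tendsto_exp_neg_one_div.eventually (hlim.eventually_const_lt hc'),
      tendsto_exp_neg_one_div.eventually hV, eventually_gt_atTop 0] with N h1 h2 hN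
    refine h1.trans_le ?_
    rw [mul_div_assoc]
    refine mul_le_mul_of_nonneg_left ?_ (Real.rpow_nonneg (hone hN).le _)
    rw [div_le_iff₀ h2, ← tsum_mul_left]
    refine (hsum hN 1 b).2.tsum_le_tsum (fun n => ?_) ((hsum hN 1 b).1.mul_left _)
    rw [mul_assoc]
    by_cases h : expTent 1 b (Real.exp (-(1 / (N : ℝ))) ^ n) = 0
    · rw [h, mul_zero, mul_zero, mul_zero]
    rw [exp_neg_one_div_pow] at h
    have h3 := (mem_Ioo_of_expTent_ne_zero hb1 h).1
    rw [lt_div_iff₀ (by positivity), one_mul, Nat.cast_lt] at h3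
    exact mul_le_mul_of_nonneg_right (hp h3.le) (hnn _ _ _ _)
  · obtain ⟨a, hac, ha⟩ := (((hcont.mono_left nhdsWithin_le_nhds).eventually_lt_const hc).and
      (Ioo_mem_nhdsLT (show (0 : ℝ) < 1 by norm_num))).exists
    have ha0 : 0 < a := ha.1
    have ha1 : a < 1 := ha.2
    have hpos := gammaMean_expTent_pos one_pos ha0 ha1
    obtain ⟨hlim, hV⟩ := tendsto_karamata_ratio hα hp0 hp1 hK0 hK (continuous_expTent a 1) hpos
    have hc' : K * gammaMean α (expTent a 1) / gammaMean 1 (expTent a 1) < c := by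
      refine lt_of_le_of_lt ?_ hac
      rw [mul_div_assoc]
      refine mul_le_mul_of_nonneg_left ?_ hK0
      rw [div_le_iff₀ hpos]
      exact (gammaMean_expTent_bounds hα hα1 ha0 ha1).2
    filter_upwards [tendsto_exp_neg_one_div.eventually (hlim.eventually_lt_const hc'),
      tendsto_exp_neg_one_div.eventually hV, eventually_gt_atTop 0] with N h1 h2 hN
    refine lt_of_le_of_lt ?_ h1
    rw [mul_div_assoc]
    refine mul_le_mul_of_nonneg_left ?_ (Real.rpow_nonneg (hone hN).le _)
    rw [le_div_iff₀ h2, ← tsum_mul_left]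
    refine ((hsum hN a 1).1.mul_left _).tsum_le_tsum (fun n => ?_) (hsum hN a 1).2
    rw [mul_assoc]
    by_cases h : expTent a 1 (Real.exp (-(1 / (N : ℝ))) ^ n) = 0
    · rw [h, mul_zero, mul_zero, mul_zero]
    rw [exp_neg_one_div_pow] at h
    have h3 := (mem_Ioo_of_expTent_ne_zero ha1 h).2
    rw [div_lt_iff₀ (by positivity), one_mul, Nat.cast_lt] at h3
    exact mul_le_mul_of_nonneg_right (hp h3.le) (hnn _ _ _ _)

lemma tendsto_nat_mul_one_sub_exp :
    Tendsto (fun N : ℕ => (N : ℝ) * (1 - Real.exp (-(1 / (N : ℝ))))) atTop (𝓝 1) := by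
  have h := (Real.hasDerivAt_exp 0).tendsto_slope
  have h1 : Tendsto (fun N : ℕ => -(1 / (N : ℝ))) atTop (𝓝[≠] 0) := by
    refine tendsto_nhdsWithin_iff.2 ⟨?_, ?_⟩
    · simpa using (tendsto_one_div_atTop_nhds_zero_nat (𝕜 := ℝ)).neg
    · filter_upwards [eventually_gt_atTop 0] with N hN
      simpa using hN.ne'
  have h2 := h.comp h1
  rw [Real.exp_zero] at h2
  refine h2.congr' ?_
  filter_upwards [eventually_gt_atTop 0] with N hN
  have : (N : ℝ) ≠ 0 := by positivity
  simp only [Function.comp_apply, slope_def_field, Real.exp_zero, sub_zero]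
  field_simp
  ring

lemma tendsto_mul_rpow_of_antitone (hα : 0 < α) (hα1 : α ≤ 1) (hp0 : ∀ n, 0 ≤ p n)
    (hp1 : ∀ n, p n ≤ 1) (hp : Antitone p) (hK0 : 0 ≤ K)
    (hK : Tendsto (fun s : ℝ => (1 - s) ^ α * ∑' n, p n * s ^ n) (𝓝[<] 1) (𝓝 K)) :
    Tendsto (fun N : ℕ => p N * (N : ℝ) ^ (1 - α)) atTop (𝓝 (K / Real.Gamma α)) := by
  have h1 := tendsto_of_antitone hα hα1 hp0 hp1 hp hK0 hK
  have h2 := tendsto_nat_mul_one_sub_exp.rpow_const (p := 1 - α) (Or.inl one_ne_zero)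
  have h3 := h1.mul h2
  rw [Real.one_rpow, mul_one] at h3
  refine h3.congr' ?_
  filter_upwards [eventually_gt_atTop 0] with N hN
  have h4 : 0 < 1 - Real.exp (-(1 / (N : ℝ))) := by
    linarith [exp_neg_one_div_lt_one hN]
  rw [Real.mul_rpow (by positivity) h4.le, show α - 1 = -(1 - α) by ring, Real.rpow_neg h4.le]
  field_simp

end Tauberian

lemma tendsto_coneProb_mul_rpow :
    Tendsto (fun n : ℕ => coneProb n * (n : ℝ) ^ ((1 : ℝ) / 3)) atTop
      (𝓝 (8 * √3 / 9 / Real.Gamma (2 / 3))) := by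
  have h := tendsto_mul_rpow_of_antitone (α := 2 / 3) (by norm_num) (by norm_num) coneProb_nonneg
    coneProb_le_one coneProb_antitone (by positivity) tendsto_coneProb_gf
  rwa [show (1 : ℝ) - 2 / 3 = 1 / 3 by norm_num] at h

end ThreeQuadrant

theorem diag_threeQuadrant_total_asymptotics :
    Asymptotics.IsEquivalent Filter.atTop
      (fun n : ℕ => (walkCountAll diagSteps coneC (0, 0) n : ℝ))
      (fun n : ℕ =>
        2^3 * Real.sqrt 3 / (3^2 * Real.Gamma (2/3)) * 4^n / (n : ℝ)^((1 : ℝ)/3)) := by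
  have hΓ : 0 < Real.Gamma (2 / 3) := Real.Gamma_pos_of_pos (by norm_num)
  have hc : (0 : ℝ) < 8 * √3 / 9 / Real.Gamma (2 / 3) := by positivity
  rw [Asymptotics.isEquivalent_iff_tendsto_one]
  · have h := ThreeQuadrant.tendsto_coneProb_mul_rpow.div_const
      (8 * √3 / 9 / Real.Gamma (2 / 3))
    rw [div_self hc.ne'] at h
    refine h.congr' ?_
    filter_upwards [Filter.eventually_gt_atTop 0] with n hn
    have hn' : (0 : ℝ) < n := by exact_mod_cast hn
    have h3 : (0 : ℝ) < √3 := by positivity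
    simp only [Pi.div_apply, ThreeQuadrant.coneProb]
    field_simp
    norm_num
  · filter_upwards [Filter.eventually_gt_atTop 0] with n hn
    have hn' : (0 : ℝ) < n := by exact_mod_cast hn
    positivity
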